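/- arXiv:1205.5869 — 3 statements merged into one kernel-verified Lean document; each statement's English description precedes it below -/
import Mathlib

section
/- Let f ∈ Lip(1,p) with p > 1, and let (a_{n,k}) be a lower triangular matrix with a_{n,k} ≥ 0 for k ≤ n, a_{n,k} = 0 for k > n, and ∑_{k=0}^n a_{n,k} = 1 for all n. If ∑_{k=0}^{n−1} |A_{n,k} − A_{n,k+1}| = O(n^{−1}), where A_{n,m} = (1/(m+1))∑_{k=0}^m a_{n,k}, then ‖T_n(f) − f‖_{L^p} = O(n^{−1}). -/
open MeasureTheory Finset Real

/-- The Dirichlet kernel `D_n(u) = 1/2 + ∑_{k=1}^n cos(k u)`. -/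
noncomputable def dirichletKernel (n : ℕ) (u : ℝ) : ℝ :=
  1 / 2 + ∑ k ∈ Finset.Icc 1 n, Real.cos (k * u)

/-- The `n`-th partial sum of the Fourier series of a `2π`-periodic function `f`,
`S_n(f;x) = (1/π) ∫_0^{2π} f(t) D_n(x - t) dt`. -/
noncomputable def partialFourierSum (f : ℝ → ℝ) (n : ℕ) (x : ℝ) : ℝ :=
  (1 / Real.pi) * ∫ t in (0 : ℝ)..(2 * Real.pi), f t * dirichletKernel n (x - t)

/-- The normalized `L^p` norm `‖f‖_{L^p} = ((1/2π) ∫_0^{2π} |f(x)|^p dx)^{1/p}`. -/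
noncomputable def lpNorm (p : ℝ) (f : ℝ → ℝ) : ℝ :=
  ((1 / (2 * Real.pi)) * ∫ x in (0 : ℝ)..(2 * Real.pi), |f x| ^ p) ^ (1 / p)

/-- The integral modulus of continuity
`ω_p(f;δ) = sup_{0<|h|≤δ} ((1/2π) ∫_0^{2π} |f(x+h) - f(x)|^p dx)^{1/p}`. -/
noncomputable def intModulus (p : ℝ) (f : ℝ → ℝ) (δ : ℝ) : ℝ :=
  sSup {y : ℝ | ∃ h : ℝ, 0 < |h| ∧ |h| ≤ δ ∧
    y = ((1 / (2 * Real.pi)) * ∫ x in (0 : ℝ)..(2 * Real.pi), |f (x + h) - f x| ^ p) ^ (1 / p)}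

/-- `f ∈ Lip(α,p)`: `f` is `2π`-periodic, belongs to `L^p[0,2π]`, and
`ω_p(f;δ) = O(δ^α)`. -/
def LipClass (α p : ℝ) (f : ℝ → ℝ) : Prop :=
  Function.Periodic f (2 * Real.pi) ∧
  IntervalIntegrable f MeasureTheory.volume 0 (2 * Real.pi) ∧
  IntervalIntegrable (fun x => |f x| ^ p) MeasureTheory.volume 0 (2 * Real.pi) ∧
  ∃ C : ℝ, 0 < C ∧ ∀ δ : ℝ, 0 < δ → intModulus p f δ ≤ C * δ ^ α

/-- The matrix transform `T_n(f;x) = ∑_{k=0}^n a_{n,k} S_k(f;x)`. -/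
noncomputable def matrixMeans (a : ℕ → ℕ → ℝ) (f : ℝ → ℝ) (n : ℕ) (x : ℝ) : ℝ :=
  ∑ k ∈ Finset.range (n + 1), a n k * partialFourierSum f k x

/-- `A_{n,m} = (1/(m+1)) ∑_{k=0}^m a_{n,k}`, the Cesàro mean of the `n`-th row. -/
noncomputable def rowMean (a : ℕ → ℕ → ℝ) (n m : ℕ) : ℝ :=
  (1 / ((m : ℝ) + 1)) * ∑ k ∈ Finset.range (m + 1), a n k

/-- The Riesz means `R_n(f;x) = (1/P_n) ∑_{k=0}^n p_k S_k(f;x)` with weights `w`. -/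
noncomputable def rieszMeans (w : ℕ → ℝ) (f : ℝ → ℝ) (n : ℕ) (x : ℝ) : ℝ :=
  (1 / (∑ k ∈ Finset.range (n + 1), w k)) *
    ∑ k ∈ Finset.range (n + 1), w k * partialFourierSum f k x

/-- The kernel `K_n(u) = ∑_{k=0}^n a_{n,k} sin((k+1/2)u)/(2 sin(u/2))`. -/
noncomputable def matrixKernel (a : ℕ → ℕ → ℝ) (n : ℕ) (u : ℝ) : ℝ :=
  ∑ k ∈ Finset.range (n + 1),
    a n k * (Real.sin (((k : ℝ) + 1 / 2) * u) / (2 * Real.sin (u / 2)))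

namespace TrigApprox

open scoped ENNReal NNReal ComplexConjugate

/-- The normalized Lebesgue measure on one period. -/
noncomputable def periodMeasure : Measure ℝ :=
  ENNReal.ofReal (2 * π)⁻¹ • volume.restrict (Set.Ioc 0 (2 * π))

instance : IsProbabilityMeasure periodMeasure := by
  constructor
  have h : (0 : ℝ) < 2 * π := by positivity
  simp only [periodMeasure, Measure.smul_apply, Measure.restrict_apply_univ, Real.volume_Ioc,
    sub_zero, smul_eq_mul]
  rw [← ENNReal.ofReal_mul (by positivity), inv_mul_cancel₀ h.ne', ENNReal.ofReal_one]

lemma integral_periodMeasure {E : Type*} [NormedAddCommGroup E] [NormedSpace ℝ E] (g : ℝ → E) :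
    ∫ x, g x ∂periodMeasure = (2 * π)⁻¹ • ∫ x in (0 : ℝ)..(2 * π), g x := by
  rw [periodMeasure, integral_smul_measure, ENNReal.toReal_ofReal (by positivity),
    intervalIntegral.integral_of_le (by positivity)]

lemma integrable_periodMeasure_iff {E : Type*} [NormedAddCommGroup E] {g : ℝ → E} :
    Integrable g periodMeasure ↔ IntervalIntegrable g volume 0 (2 * π) := by
  rw [periodMeasure, integrable_smul_measure (by simp; positivity) (by simp),
    intervalIntegrable_iff_integrableOn_Ioc_of_le (by positivity), IntegrableOn]

lemma _root_.Continuous.integrable_periodMeasure {E : Type*} [NormedAddCommGroup E] {g : ℝ → E}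
    (hg : Continuous g) : Integrable g periodMeasure :=
  integrable_periodMeasure_iff.2 (hg.intervalIntegrable _ _)

/-- A continuous function has finite `L^p` norm over a period. -/
lemma _root_.Continuous.memLp_periodMeasure {E : Type*} [NormedAddCommGroup E]
    [SecondCountableTopologyEither ℝ E] {g : ℝ → E}
    (hg : Continuous g) (q : ℝ≥0∞) : MemLp g q periodMeasure := by
  obtain ⟨C, hC⟩ := isCompact_Icc.exists_bound_of_continuousOn
    (hg.continuousOn (s := Set.Icc 0 (2 * π)))
  refine MemLp.of_bound hg.aestronglyMeasurable C ?_
  refine Measure.ae_smul_measure ?_ _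
  filter_upwards [ae_restrict_mem measurableSet_Ioc] with x hx
  exact hC x (Set.Ioc_subset_Icc_self hx)

lemma integral_circleMap_eq {F : ℂ → ℂ} (hF : DiffContOnCl ℂ F (Metric.ball 0 1)) :
    ∫ x, F (circleMap 0 1 x) ∂periodMeasure = F 0 := by
  rw [integral_periodMeasure]
  have := DiffContOnCl.circleAverage (f := F) (c := 0) (R := 1) (by simpa using hF)
  rwa [circleAverage_def] at this

/-- The polynomial `P` evaluated along the unit circle. -/
noncomputable def onCircle (P : Polynomial ℂ) (x : ℝ) : ℂ := P.eval (circleMap 0 1 x)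

@[fun_prop]
lemma continuous_onCircle (P : Polynomial ℂ) : Continuous (onCircle P) :=
  P.continuous.comp (continuous_circleMap 0 1)

lemma integral_onCircle (P : Polynomial ℂ) :
    ∫ x, onCircle P x ∂periodMeasure = P.eval 0 :=
  integral_circleMap_eq P.differentiable.diffContOnCl

/-- The planar inequality behind the boundedness of conjugation for positive functions. -/
lemma exists_abs_im_rpow_le {p : ℝ} (hp : 1 < p) (hp2 : p ≤ 2) :
    ∃ A B : ℝ, 0 ≤ A ∧ 0 ≤ B ∧ ∀ z : ℂ, 0 < z.re →
      |z.im| ^ p ≤ A * z.re ^ p - B * (z ^ (p : ℂ)).re := by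
  have hp0 : 0 < p := by linarith
  set θ₀ : ℝ := (π / (2 * p) + π / 2) / 2 with hθ₀
  have hlt : π / (2 * p) < π / 2 := by
    apply div_lt_div_of_pos_left Real.pi_pos (by norm_num); linarith
  have hpos : 0 < π / (2 * p) := by positivity
  have h1 : 0 < θ₀ := by rw [hθ₀]; linarith
  have h2 : θ₀ < π / 2 := by rw [hθ₀]; linarith
  have h3 : π / 2 < p * θ₀ := by
    have : p * (π / (2 * p)) = π / 2 := by field_simp
    have h' : π / (2 * p) < θ₀ := by rw [hθ₀]; linarith
    have := mul_lt_mul_of_pos_left h' hp0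
    linarith
  have h4 : p * θ₀ < π := by nlinarith [Real.pi_pos]
  have hc : 0 < cos θ₀ := cos_pos_of_mem_Ioo ⟨by linarith, h2⟩
  have hcp : cos (p * θ₀) < 0 := cos_neg_of_pi_div_two_lt_of_lt h3 (by linarith)
  set B : ℝ := 1 / (-cos (p * θ₀)) with hB
  have hB0 : 0 ≤ B := by rw [hB]; apply div_nonneg zero_le_one; linarith
  set A : ℝ := (1 + B) / cos θ₀ ^ p with hA
  have hA0 : 0 ≤ A := by rw [hA]; positivity
  refine ⟨A, B, hA0, hB0, fun z hz => ?_⟩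
  have hz0 : z ≠ 0 := fun h => by simp [h] at hz
  set r := ‖z‖ with hr
  set θ := z.arg with hθ
  have hr0 : 0 < r := norm_pos_iff.2 hz0
  have hre : z.re = r * cos θ := by
    rw [hr, hθ, Complex.norm_mul_cos_arg]
  have him : z.im = r * sin θ := by
    rw [hr, hθ, Complex.norm_mul_sin_arg]
  have hcos : 0 < cos θ := by
    rw [hre] at hz; exact pos_of_mul_pos_right hz hr0.le
  have hθ2 : |θ| < π / 2 := Complex.abs_arg_lt_pi_div_two_iff.2 (Or.inl hz)
  have hpow : (z ^ (p : ℂ)).re = r ^ p * cos (p * θ) := by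
    rw [Complex.cpow_ofReal_re, ← hr, ← hθ, mul_comm θ]
  have hkey : |sin θ| ^ p ≤ A * cos θ ^ p - B * cos (p * θ) := by
    have hs : |sin θ| ^ p ≤ 1 := rpow_le_one (abs_nonneg _) (abs_sin_le_one _) hp0.le
    have e1 : cos (p * θ) = cos (p * |θ|) := by
      rw [← cos_abs (p * θ), abs_mul, abs_of_pos hp0]
    have e2 : cos θ = cos |θ| := (cos_abs θ).symm
    rcases le_total θ₀ |θ| with h | h
    · have hle : cos (p * |θ|) ≤ cos (p * θ₀) := by
        apply cos_le_cos_of_nonneg_of_le_pi (by positivity) (by nlinarith)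
        exact mul_le_mul_of_nonneg_left h hp0.le
      have hBm : 1 ≤ -(B * cos (p * θ)) := by
        rw [e1, hB, ← mul_neg, one_div, inv_mul_eq_div, le_div_iff₀ (by linarith)]
        linarith
      have : 0 ≤ A * cos θ ^ p := by positivity
      linarith
    · have hle : cos θ₀ ≤ cos θ := by
        rw [e2]; exact cos_le_cos_of_nonneg_of_le_pi (abs_nonneg _) (by linarith) h
      have hle' : cos θ₀ ^ p ≤ cos θ ^ p := rpow_le_rpow hc.le hle hp0.le
      have hAm : 1 + B ≤ A * cos θ ^ p := by
        rw [hA, div_mul_eq_mul_div, le_div_iff₀ (by positivity)]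
        exact mul_le_mul_of_nonneg_left hle' (by linarith)
      have : B * cos (p * θ) ≤ B := by nlinarith [cos_le_one (p * θ)]
      linarith
  rw [him, hpow, hre, abs_mul, abs_of_pos hr0, mul_rpow hr0.le (abs_nonneg _),
    mul_rpow hr0.le hcos.le]
  have := mul_le_mul_of_nonneg_left hkey (rpow_nonneg hr0.le p)
  linarith

/-- A polynomial whose real part is at least `δ` on the unit circle has this property on the
closed disc. -/
lemma re_eval_ge_of_circle {P : Polynomial ℂ} {δ : ℝ} (h : ∀ x, δ ≤ (onCircle P x).re) {z : ℂ}
    (hz : z ∈ Metric.closedBall (0 : ℂ) 1) : δ ≤ (P.eval z).re := by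
  have hd : DiffContOnCl ℂ (fun w => Complex.exp (-P.eval w)) (Metric.ball 0 1) :=
    (Complex.differentiable_exp.comp P.differentiable.neg).diffContOnCl
  have := Complex.norm_le_of_forall_mem_frontier_norm_le Metric.isBounded_ball hd
    (C := Real.exp (-δ)) (fun w hw => ?_) (z := z) (by
      rwa [closure_ball _ one_ne_zero])
  · rw [Complex.norm_exp, Real.exp_le_exp, Complex.neg_re] at this
    linarith
  · rw [frontier_ball _ one_ne_zero, ← abs_one (α := ℝ), ← range_circleMap] at hw
    obtain ⟨x, rfl⟩ := hw
    rw [Complex.norm_exp, Real.exp_le_exp, Complex.neg_re]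
    have := h x
    rw [onCircle] at this
    linarith

lemma integral_abs_im_rpow_le_of_pos {p A B : ℝ} (hp : 1 < p) (hB : 0 ≤ B)
    (hAB : ∀ z : ℂ, 0 < z.re → |z.im| ^ p ≤ A * z.re ^ p - B * (z ^ (p : ℂ)).re)
    {P : Polynomial ℂ} {δ : ℝ} (hδ : 0 < δ)
    (h : ∀ x, δ ≤ (onCircle P x).re) (h0 : (P.eval 0).im = 0) :
    ∫ x, |(onCircle P x).im| ^ p ∂periodMeasure ≤
      A * ∫ x, |(onCircle P x).re| ^ p ∂periodMeasure := by
  have hp0 : 0 < p := by linarith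
  have hre := fun z hz => re_eval_ge_of_circle (P := P) (z := z) h hz
  have hslit : ∀ z ∈ Metric.closedBall (0 : ℂ) 1, P.eval z ∈ Complex.slitPlane := fun z hz =>
    Or.inl (hδ.trans_le (hre z hz))
  have hd : DiffContOnCl ℂ (fun z => P.eval z ^ (p : ℂ)) (Metric.ball 0 1) := by
    constructor
    · intro z hz
      exact (P.differentiable z).differentiableWithinAt.cpow_const
        (hslit z (Metric.ball_subset_closedBall hz))
    · rw [closure_ball _ one_ne_zero]
      exact P.continuous.continuousOn.cpow_const hslit
  have hmean := integral_circleMap_eq hd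
  have hcpow : Continuous fun x => onCircle P x ^ (p : ℂ) := by
    refine Continuous.cpow (continuous_onCircle P) continuous_const fun x => ?_
    exact Or.inl (hδ.trans_le (h x))
  have hcre : Continuous fun x => |(onCircle P x).re| ^ p :=
    (Complex.continuous_re.comp (continuous_onCircle P)).abs.rpow_const fun _ => Or.inr hp0.le
  have hcim : Continuous fun x => |(onCircle P x).im| ^ p :=
    (Complex.continuous_im.comp (continuous_onCircle P)).abs.rpow_const fun _ => Or.inr hp0.le
  have hcpre : Continuous fun x => (onCircle P x ^ (p : ℂ)).re := Complex.continuous_re.comp hcpow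
  have hint : ∫ x, (onCircle P x ^ (p : ℂ)).re ∂periodMeasure = (P.eval 0 ^ (p : ℂ)).re := by
    rw [← hmean]
    exact integral_re (𝕜 := ℂ) hcpow.integrable_periodMeasure
  have hge : 0 ≤ (P.eval 0 ^ (p : ℂ)).re := by
    have : P.eval 0 = (((P.eval 0).re : ℝ) : ℂ) := Complex.ext rfl (by simpa using h0)
    have h0' : 0 ≤ (P.eval 0).re := hδ.le.trans (hre 0 (by simp))
    rw [this, ← Complex.ofReal_cpow h0', Complex.ofReal_re]
    positivity
  calc ∫ x, |(onCircle P x).im| ^ p ∂periodMeasure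
      ≤ ∫ x, (A * |(onCircle P x).re| ^ p - B * (onCircle P x ^ (p : ℂ)).re) ∂periodMeasure := by
        refine integral_mono hcim.integrable_periodMeasure
          ((hcre.const_mul _).sub (hcpre.const_mul _)).integrable_periodMeasure fun x => ?_
        have hx : 0 < (onCircle P x).re := hδ.trans_le (h x)
        simpa [abs_of_pos hx] using hAB _ hx
    _ = A * ∫ x, |(onCircle P x).re| ^ p ∂periodMeasure - B * (P.eval 0 ^ (p : ℂ)).re := by
        rw [integral_sub (hcre.const_mul _).integrable_periodMeasure
          (hcpre.const_mul _).integrable_periodMeasure, integral_const_mul, integral_const_mul,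
          hint]
    _ ≤ _ := by nlinarith

/-- Conjugation is square-integrable contractive. -/
lemma integral_im_sq_le {P : Polynomial ℂ} (h0 : (P.eval 0).im = 0) :
    ∫ x, |(onCircle P x).im| ^ (2 : ℝ) ∂periodMeasure ≤
      1 * ∫ x, |(onCircle P x).re| ^ (2 : ℝ) ∂periodMeasure := by
  have hm := integral_onCircle (P ^ 2)
  have hre : Continuous fun x => (onCircle P x).re ^ 2 :=
    (Complex.continuous_re.comp (continuous_onCircle P)).pow 2
  have him : Continuous fun x => (onCircle P x).im ^ 2 :=
    (Complex.continuous_im.comp (continuous_onCircle P)).pow 2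
  have hint := integral_re (𝕜 := ℂ) (continuous_onCircle (P ^ 2)).integrable_periodMeasure
  rw [hm] at hint
  have e : ∀ x, RCLike.re (onCircle (P ^ 2) x) = (onCircle P x).re ^ 2 - (onCircle P x).im ^ 2 := by
    intro x
    simp [onCircle, sq]
  simp only [e] at hint
  rw [integral_sub hre.integrable_periodMeasure him.integrable_periodMeasure] at hint
  have h1 : RCLike.re ((P ^ 2).eval 0) = (P.eval 0).re ^ 2 := by simp [sq, h0]
  rw [h1] at hint
  simp only [rpow_two, sq_abs, one_mul]
  nlinarith [sq_nonneg (P.eval 0).re]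

/-- The normalized `L^p` seminorm over a period, as an extended nonnegative real. -/
noncomputable abbrev periodNorm {E : Type*} [NormedAddCommGroup E] (p : ℝ) (g : ℝ → E) : ℝ≥0∞ :=
  eLpNorm g (ENNReal.ofReal p) periodMeasure

lemma periodNorm_eq_ofReal {E : Type*} [NormedAddCommGroup E] {p : ℝ} (hp : 0 < p) {g : ℝ → E}
    (hg : MemLp g (ENNReal.ofReal p) periodMeasure) :
    periodNorm p g = ENNReal.ofReal ((∫ x, ‖g x‖ ^ p ∂periodMeasure) ^ (1 / p)) := by
  rw [periodNorm, hg.eLpNorm_eq_integral_rpow_norm (by simpa using hp) (by simp),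
    ENNReal.toReal_ofReal hp.le, one_div]

lemma periodNorm_le_of_integral_le {p A : ℝ} (hp : 0 < p) (hA : 0 ≤ A) {g h : ℝ → ℝ}
    (hg : Continuous g) (hh : Continuous h)
    (hgh : ∫ x, |g x| ^ p ∂periodMeasure ≤ A * ∫ x, |h x| ^ p ∂periodMeasure) :
    periodNorm p g ≤ ENNReal.ofReal (A ^ (1 / p)) * periodNorm p h := by
  rw [periodNorm_eq_ofReal hp (hg.memLp_periodMeasure _),
    periodNorm_eq_ofReal hp (hh.memLp_periodMeasure _), ← ENNReal.ofReal_mul (by positivity)]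
  apply ENNReal.ofReal_le_ofReal
  rw [← mul_rpow hA (integral_nonneg fun x => by positivity)]
  apply rpow_le_rpow (integral_nonneg fun x => by positivity) _ (by positivity)
  simpa [Real.norm_eq_abs] using hgh

lemma periodMeasure_absolutelyContinuous : periodMeasure ≪ volume :=
  (Measure.absolutelyContinuous_of_le Measure.restrict_le_self).smul_left _

lemma lintegral_periodMeasure (F : ℝ → ℝ≥0∞) :
    ∫⁻ x, F x ∂periodMeasure =
      ENNReal.ofReal (2 * π)⁻¹ * ∫⁻ x in Set.Ioc 0 (2 * π), F x := by
  rw [periodMeasure, lintegral_smul_measure, smul_eq_mul]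

lemma lintegral_add_right_of_periodic {F : ℝ → ℝ≥0∞} (hF : Function.Periodic F (2 * π)) (h : ℝ) :
    ∫⁻ x, F (x + h) ∂periodMeasure = ∫⁻ x, F x ∂periodMeasure := by
  have : Fact (0 < 2 * π) := ⟨by positivity⟩
  simp only [lintegral_periodMeasure]
  congr 1
  have key : ∀ t, ∫⁻ x in Set.Ioc t (t + 2 * π), F x = ∫⁻ b, hF.lift b := fun t => by
    rw [← AddCircle.lintegral_preimage (2 * π) t]
    simp only [Function.Periodic.lift_coe]
  have h1 := (measurePreserving_add_right volume h).setLIntegral_comp_preimage_emb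
    (measurableEmbedding_addRight h) F (Set.Ioc h (h + 2 * π))
  have h2 : (fun x => x + h) ⁻¹' Set.Ioc h (h + 2 * π) = Set.Ioc 0 (2 * π) := by
    rw [Set.preimage_add_const_Ioc]; simp
  rw [h2] at h1
  rw [h1, key h, ← key 0, zero_add]

lemma periodNorm_eq_lintegral {E : Type*} [NormedAddCommGroup E] {p : ℝ} (hp : 0 < p)
    (g : ℝ → E) : periodNorm p g = (∫⁻ x, ‖g x‖ₑ ^ p ∂periodMeasure) ^ (1 / p) := by
  rw [periodNorm, eLpNorm_eq_lintegral_rpow_enorm_toReal (by simpa using hp) (by simp),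
    ENNReal.toReal_ofReal hp.le]

lemma periodNorm_rpow {E : Type*} [NormedAddCommGroup E] {p : ℝ} (hp : 0 < p)
    (g : ℝ → E) : periodNorm p g ^ p = ∫⁻ x, ‖g x‖ₑ ^ p ∂periodMeasure := by
  rw [periodNorm_eq_lintegral hp, ← ENNReal.rpow_mul, one_div_mul_cancel hp.ne', ENNReal.rpow_one]

lemma periodNorm_add_right {E : Type*} [NormedAddCommGroup E] {p : ℝ} (hp : 0 < p) {g : ℝ → E}
    (hg : Function.Periodic g (2 * π)) (h : ℝ) :
    periodNorm p (fun x => g (x + h)) = periodNorm p g := by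
  rw [periodNorm_eq_lintegral hp, periodNorm_eq_lintegral hp]
  congr 1
  exact lintegral_add_right_of_periodic (F := fun x => ‖g x‖ₑ ^ p) (fun x => by simp only [hg x]) h

lemma aestronglyMeasurable_of_periodic {g : ℝ → ℝ} (hg : Function.Periodic g (2 * π))
    (hi : Integrable g periodMeasure) : AEStronglyMeasurable g volume := by
  have h := hg.intervalIntegrable₀ (by positivity) (integrable_periodMeasure_iff.1 hi)
  refine LocallyIntegrable.aestronglyMeasurable (locallyIntegrable_iff.2 fun k hk => ?_)
  obtain ⟨R, hR⟩ := hk.isBounded.subset_closedBall 0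
  rw [Real.closedBall_eq_Icc] at hR
  rcases le_total (0 - R) (0 + R) with hle | hle
  · exact ((intervalIntegrable_iff_integrableOn_Icc_of_le hle).1 (h _ _)).mono_set hR
  · have : volume k = 0 := measure_mono_null hR (by simp; linarith)
    rw [IntegrableOn, Measure.restrict_eq_zero.2 this]
    exact integrable_zero_measure

/-- Minkowski's integral inequality for averages, in the form given by Jensen's inequality. -/
lemma periodNorm_integral_rpow_le {p : ℝ} (hp : 1 ≤ p) {κ : Measure ℝ} [IsProbabilityMeasure κ]
    {Φ : ℝ → ℝ → ℝ} (hΦ : AEStronglyMeasurable (Function.uncurry Φ) (periodMeasure.prod κ)) :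
    periodNorm p (fun x => ∫ s, Φ x s ∂κ) ^ p ≤ ∫⁻ s, periodNorm p (fun x => Φ x s) ^ p ∂κ := by
  have hp0 : 0 < p := by linarith
  simp only [periodNorm_rpow hp0]
  rw [← lintegral_lintegral_swap (f := fun x s => ‖Φ x s‖ₑ ^ p) (hΦ.enorm.pow_const p)]
  refine lintegral_mono_ae ?_
  filter_upwards [hΦ.prodMk_left] with x hx
  have h1 : ‖∫ s, Φ x s ∂κ‖ₑ ≤ eLpNorm (Φ x) 1 κ := by
    rw [eLpNorm_one_eq_lintegral_enorm]
    exact enorm_integral_le_lintegral_enorm _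
  have h2 : eLpNorm (Φ x) 1 κ ≤ eLpNorm (Φ x) (ENNReal.ofReal p) κ :=
    eLpNorm_le_eLpNorm_of_exponent_le (by simpa using hp) hx
  have h3 := ENNReal.rpow_le_rpow (h1.trans h2) hp0.le
  rwa [eLpNorm_eq_lintegral_rpow_enorm_toReal (by simpa using hp0) (by simp),
    ENNReal.toReal_ofReal hp0.le, ← ENNReal.rpow_mul, one_div_mul_cancel hp0.ne',
    ENNReal.rpow_one] at h3

/-- The unnormalized de la Vallée-Poussin weight. -/
noncomputable def vpWeight (m : ℕ) (s : ℝ) : ℝ := ((1 + cos s) / 2) ^ m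

/-- The mean of the de la Vallée-Poussin weight. -/
noncomputable def vpMass (m : ℕ) : ℝ := ∫ s, vpWeight m s ∂periodMeasure

/-- The de la Vallée-Poussin kernel, with mean one. -/
noncomputable def vpKernel (m : ℕ) (s : ℝ) : ℝ := (vpMass m)⁻¹ * vpWeight m s

@[fun_prop]
lemma continuous_vpWeight (m : ℕ) : Continuous (vpWeight m) := by
  unfold vpWeight; fun_prop

@[fun_prop]
lemma continuous_vpKernel (m : ℕ) : Continuous (vpKernel m) := by
  unfold vpKernel; fun_prop

lemma vpWeight_nonneg (m : ℕ) (s : ℝ) : 0 ≤ vpWeight m s :=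
  pow_nonneg (by linarith [neg_one_le_cos s]) m

lemma vpWeight_eq_cos_half (m : ℕ) (s : ℝ) : vpWeight m s = cos (s / 2) ^ (2 * m) := by
  rw [vpWeight, pow_mul, cos_sq]
  congr 1
  rw [mul_div_cancel₀ s two_ne_zero]
  ring

lemma vpMass_eq (m : ℕ) : vpMass m = (2 * π)⁻¹ * (2 * ∫ s in (0 : ℝ)..π, cos s ^ (2 * m)) := by
  rw [vpMass, integral_periodMeasure]
  simp only [vpWeight_eq_cos_half]
  rw [intervalIntegral.integral_comp_div (fun s => cos s ^ (2 * m)) two_ne_zero]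
  simp

lemma vpMass_succ (m : ℕ) : vpMass (m + 1) = (2 * m + 1) / (2 * m + 2) * vpMass m := by
  rw [vpMass_eq, vpMass_eq, mul_add, mul_one, integral_cos_pow]
  simp
  ring

lemma vpMass_pos (m : ℕ) : 0 < vpMass m := by
  induction m with
  | zero => simp [vpMass, vpWeight]
  | succ m ih => rw [vpMass_succ]; positivity

lemma vpKernel_nonneg (m : ℕ) (s : ℝ) : 0 ≤ vpKernel m s :=
  mul_nonneg (inv_nonneg.2 (vpMass_pos m).le) (vpWeight_nonneg m s)

lemma integral_vpKernel (m : ℕ) : ∫ s, vpKernel m s ∂periodMeasure = 1 := by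
  simp only [vpKernel]
  rw [integral_const_mul]
  exact inv_mul_cancel₀ (vpMass_pos m).ne'

lemma integral_vpKernel_mul_sin_sq (m : ℕ) :
    ∫ s, vpKernel m s * sin (s / 2) ^ 2 ∂periodMeasure = 1 / (2 * m + 2) := by
  have e : ∀ s, vpKernel m s * sin (s / 2) ^ 2 =
      vpKernel m s - (vpMass m)⁻¹ * vpWeight (m + 1) s := fun s => by
    rw [vpKernel, vpWeight_eq_cos_half, vpWeight_eq_cos_half, sin_sq]
    ring
  simp only [e]
  rw [integral_sub (continuous_vpKernel m).integrable_periodMeasure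
    ((continuous_vpWeight _).const_mul _).integrable_periodMeasure, integral_vpKernel,
    integral_const_mul]
  change 1 - (vpMass m)⁻¹ * vpMass (m + 1) = _
  rw [vpMass_succ]
  have := (vpMass_pos m).ne'
  field_simp
  ring

/-- The probability measure with de la Vallée-Poussin density. -/
noncomputable def vpMeasure (m : ℕ) : Measure ℝ :=
  periodMeasure.withDensity fun s => ENNReal.ofReal (vpKernel m s)

lemma measurable_vpDensity (m : ℕ) : Measurable fun s => ENNReal.ofReal (vpKernel m s) :=
  (continuous_vpKernel m).measurable.ennreal_ofReal

instance (m : ℕ) : IsProbabilityMeasure (vpMeasure m) := by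
  constructor
  rw [vpMeasure, withDensity_apply _ MeasurableSet.univ, Measure.restrict_univ,
    ← ofReal_integral_eq_lintegral_ofReal (continuous_vpKernel m).integrable_periodMeasure
      (Filter.Eventually.of_forall (vpKernel_nonneg m)), integral_vpKernel, ENNReal.ofReal_one]

lemma integral_vpMeasure (m : ℕ) (g : ℝ → ℝ) :
    ∫ s, g s ∂vpMeasure m = ∫ s, vpKernel m s * g s ∂periodMeasure := by
  rw [vpMeasure, integral_withDensity_eq_integral_toReal_smul (measurable_vpDensity m)
    (Filter.Eventually.of_forall fun _ => ENNReal.ofReal_lt_top)]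
  simp only [ENNReal.toReal_ofReal (vpKernel_nonneg m _), smul_eq_mul]

lemma vpKernel_le (m : ℕ) (s : ℝ) : vpKernel m s ≤ (vpMass m)⁻¹ := by
  refine mul_le_of_le_one_right (inv_nonneg.2 (vpMass_pos m).le) (pow_le_one₀ ?_ ?_)
  · linarith [neg_one_le_cos s]
  · linarith [cos_le_one s]

lemma integrable_vpMeasure {m : ℕ} {g : ℝ → ℝ} (hg : Integrable g periodMeasure) :
    Integrable g (vpMeasure m) := by
  rw [vpMeasure, integrable_withDensity_iff_integrable_smul' (measurable_vpDensity m)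
    (Filter.Eventually.of_forall fun _ => ENNReal.ofReal_lt_top)]
  simp only [ENNReal.toReal_ofReal (vpKernel_nonneg m _), smul_eq_mul]
  refine hg.bdd_mul (continuous_vpKernel m).aestronglyMeasurable (c := (vpMass m)⁻¹)
    (Filter.Eventually.of_forall fun s => ?_)
  rw [Real.norm_of_nonneg (vpKernel_nonneg m s)]
  exact vpKernel_le m s

/-- The absolute first moment of the de la Vallée-Poussin measure tends to zero. -/
lemma lintegral_abs_sin_vpMeasure_le (m : ℕ) :
    ∫⁻ s, ENNReal.ofReal |sin (s / 2)| ∂vpMeasure m ≤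
      ENNReal.ofReal ((1 / (2 * m + 2 : ℝ)) ^ (1 / 2 : ℝ)) := by
  have hc : Continuous fun s : ℝ => |sin (s / 2)| := by fun_prop
  have h := eLpNorm_le_eLpNorm_of_exponent_le (p := 1) (q := ENNReal.ofReal 2)
    (μ := vpMeasure m) (f := fun s : ℝ => |sin (s / 2)|) (by simp)
    hc.aestronglyMeasurable
  rw [eLpNorm_one_eq_lintegral_enorm, eLpNorm_eq_lintegral_rpow_enorm_toReal (by simp) (by simp),
    ENNReal.toReal_ofReal (by norm_num)] at h
  have e1 : ∀ s : ℝ, ‖|sin (s / 2)|‖ₑ = ENNReal.ofReal |sin (s / 2)| := fun s => by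
    rw [Real.enorm_eq_ofReal (abs_nonneg _)]
  have e2 : ∀ s : ℝ, ENNReal.ofReal |sin (s / 2)| ^ (2 : ℝ) = ENNReal.ofReal (sin (s / 2) ^ 2) :=
    fun s => by
      rw [ENNReal.ofReal_rpow_of_nonneg (abs_nonneg _) (by norm_num), rpow_two, sq_abs]
  simp only [e1, e2] at h
  rw [← ofReal_integral_eq_lintegral_ofReal (integrable_vpMeasure
    (Continuous.integrable_periodMeasure (by fun_prop)))
    (Filter.Eventually.of_forall fun _ => sq_nonneg _), integral_vpMeasure,
    integral_vpKernel_mul_sin_sq, ENNReal.ofReal_rpow_of_nonneg (by positivity) (by norm_num)] at h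
  exact h

/-- Real trigonometric polynomials, as real parts of polynomials on the unit circle. -/
def IsTrigPoly (u : ℝ → ℝ) : Prop := ∃ P : Polynomial ℂ, ∀ x, u x = (onCircle P x).re

lemma onCircle_add (P Q : Polynomial ℂ) (x : ℝ) :
    onCircle (P + Q) x = onCircle P x + onCircle Q x := by simp [onCircle]

lemma onCircle_sub (P Q : Polynomial ℂ) (x : ℝ) :
    onCircle (P - Q) x = onCircle P x - onCircle Q x := by simp [onCircle]

lemma onCircle_mul (P Q : Polynomial ℂ) (x : ℝ) :
    onCircle (P * Q) x = onCircle P x * onCircle Q x := by simp [onCircle]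

lemma onCircle_C (c : ℂ) (x : ℝ) : onCircle (Polynomial.C c) x = c := by simp [onCircle]

lemma onCircle_X (x : ℝ) : onCircle Polynomial.X x = circleMap 0 1 x := by simp [onCircle]

lemma onCircle_eq_sum (P : Polynomial ℂ) (x : ℝ) :
    onCircle P x = ∑ j ∈ range (P.natDegree + 1), P.coeff j * circleMap 0 1 x ^ j := by
  rw [onCircle, Polynomial.eval_eq_sum_range]

lemma onCircle_periodic (P : Polynomial ℂ) : Function.Periodic (onCircle P) (2 * π) := fun x => by
  rw [onCircle, onCircle, periodic_circleMap]

lemma circleMap_re (x : ℝ) : (circleMap 0 1 x).re = cos x := by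
  simp [circleMap, Complex.exp_ofReal_mul_I_re]

lemma circleMap_im (x : ℝ) : (circleMap 0 1 x).im = sin x := by
  simp [circleMap, Complex.exp_ofReal_mul_I_im]

lemma circleMap_zero_one_sub (x s : ℝ) :
    circleMap 0 1 (x - s) = circleMap 0 1 x * circleMap 0 1 (-s) := by
  simp [circleMap, sub_eq_add_neg, add_mul, Complex.exp_add]

lemma IsTrigPoly.add {u v : ℝ → ℝ} (hu : IsTrigPoly u) (hv : IsTrigPoly v) :
    IsTrigPoly fun x => u x + v x := by
  obtain ⟨P, hP⟩ := hu
  obtain ⟨Q, hQ⟩ := hv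
  exact ⟨P + Q, fun x => by simp [onCircle_add, hP, hQ]⟩

lemma IsTrigPoly.const_mul {u : ℝ → ℝ} (hu : IsTrigPoly u) (c : ℝ) :
    IsTrigPoly fun x => c * u x := by
  obtain ⟨P, hP⟩ := hu
  exact ⟨Polynomial.C (c : ℂ) * P, fun x => by simp [onCircle_mul, onCircle_C, hP]⟩

lemma IsTrigPoly.mul_cos {u : ℝ → ℝ} (hu : IsTrigPoly u) : IsTrigPoly fun x => u x * cos x := by
  obtain ⟨P, hP⟩ := hu
  simp only [hP]
  clear hP
  induction P using Polynomial.induction_on' with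
  | add P Q hP hQ =>
    have := hP.add hQ
    simpa only [onCircle_add, Complex.add_re, add_mul] using this
  | monomial j a =>
    cases j with
    | zero =>
      refine ⟨Polynomial.C (a.re : ℂ) * Polynomial.X, fun x => ?_⟩
      simp [onCircle_C, onCircle_mul, onCircle_X, circleMap_re, Polynomial.monomial_zero_left]
    | succ j =>
      refine ⟨Polynomial.monomial (j + 2) (a / 2) + Polynomial.monomial j (a / 2), fun x => ?_⟩
      have h1 := circleMap_re x
      have h2 := circleMap_im x
      simp only [onCircle, Polynomial.eval_add, Polynomial.eval_monomial]
      set z := circleMap 0 1 x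
      have e1 : a * z ^ (j + 1) = (a * z ^ j) * z := by ring
      have e2 : a / 2 * z ^ (j + 2) = ((1 / 2 : ℝ) : ℂ) * ((a * z ^ j) * (z * z)) := by
        push_cast; ring
      have e3 : a / 2 * z ^ j = ((1 / 2 : ℝ) : ℂ) * (a * z ^ j) := by push_cast; ring
      rw [e1, e2, e3]
      set b := a * z ^ j
      rw [Complex.add_re, Complex.re_ofReal_mul, Complex.re_ofReal_mul]
      simp only [Complex.mul_re, Complex.mul_im, h1, h2]
      have := sin_sq_add_cos_sq x
      linear_combination (1 / 2 * b.re) * this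

lemma isTrigPoly_vpKernel (m : ℕ) : IsTrigPoly (vpKernel m) := by
  have h : IsTrigPoly (vpWeight m) := by
    induction m with
    | zero => exact ⟨1, fun x => by simp [vpWeight, onCircle]⟩
    | succ m ih =>
      have := (ih.const_mul (1 / 2)).add (ih.mul_cos.const_mul (1 / 2))
      convert this using 2 with x
      simp only [vpWeight]
      ring
  exact h.const_mul _

/-- Convolution over a period is commutative. -/
lemma integral_mul_comp_sub {f k : ℝ → ℝ} (hf : Function.Periodic f (2 * π))
    (hk : Function.Periodic k (2 * π)) (x : ℝ) :
    ∫ s, k s * f (x - s) ∂periodMeasure = ∫ s, k (x - s) * f s ∂periodMeasure := by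
  rw [integral_periodMeasure, integral_periodMeasure]
  congr 1
  have h := intervalIntegral.integral_comp_sub_left (a := 0) (b := 2 * π)
    (fun s => k (x - s) * f s) x
  simp only [sub_sub_cancel, sub_zero] at h
  rw [h]
  have hper : Function.Periodic (fun s => k (x - s) * f s) (2 * π) := fun s => by
    change k (x - (s + 2 * π)) * f (s + 2 * π) = k (x - s) * f s
    rw [hf, ← hk (x - (s + 2 * π))]
    congr 2; ring
  have := hper.intervalIntegral_add_eq (x - 2 * π) 0
  simpa using this

lemma isTrigPoly_convolution {f k : ℝ → ℝ} (hf : Function.Periodic f (2 * π))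
    (hi : Integrable f periodMeasure) (hk : IsTrigPoly k) :
    IsTrigPoly fun x => ∫ s, k s * f (x - s) ∂periodMeasure := by
  obtain ⟨Q, hQ⟩ := hk
  have hkper : Function.Periodic k (2 * π) := fun x => by rw [hQ, hQ, onCircle_periodic]
  simp only [integral_mul_comp_sub hf hkper]
  refine ⟨∑ j ∈ range (Q.natDegree + 1), Polynomial.monomial j
    (Q.coeff j * ∫ s, circleMap 0 1 (-s) ^ j * f s ∂periodMeasure), fun x => ?_⟩
  have hint : ∀ j : ℕ, Integrable (fun s => circleMap 0 1 (-s) ^ j * (f s : ℂ)) periodMeasure := by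
    intro j
    refine hi.ofReal.bdd_mul (c := 1) (Continuous.aestronglyMeasurable ?_)
      (Filter.Eventually.of_forall fun s => by simp)
    exact ((continuous_circleMap 0 1).comp continuous_neg).pow j
  have e : ∀ s, k (x - s) * f s = RCLike.re (∑ j ∈ range (Q.natDegree + 1),
      Q.coeff j * circleMap 0 1 x ^ j * (circleMap 0 1 (-s) ^ j * (f s : ℂ))) := by
    intro s
    rw [hQ, onCircle_eq_sum, circleMap_zero_one_sub, ← Complex.re_mul_ofReal]
    rw [sum_mul]
    congr 1
    refine sum_congr rfl fun j _ => ?_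
    ring
  simp only [e]
  rw [integral_re (𝕜 := ℂ) (integrable_finsetSum _ fun j _ => (hint j).const_mul _),
    integral_finsetSum _ fun j _ => (hint j).const_mul _]
  simp only [integral_const_mul, onCircle, Polynomial.eval_finsetSum, Polynomial.eval_monomial]
  refine congrArg Complex.re (sum_congr rfl fun j _ => ?_)
  ring

lemma integrable_comp_sub {f : ℝ → ℝ} (hf : Function.Periodic f (2 * π))
    (hi : Integrable f periodMeasure) (x : ℝ) : Integrable (fun s => f (x - s)) periodMeasure := by
  rw [integrable_periodMeasure_iff] at hi ⊢
  have := (hf.intervalIntegrable₀ (by positivity) hi x (x - 2 * π)).comp_sub_left x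
  simpa using this

lemma vpMeasure_absolutelyContinuous (m : ℕ) : vpMeasure m ≪ volume :=
  (withDensity_absolutelyContinuous _ _).trans periodMeasure_absolutelyContinuous

lemma aestronglyMeasurable_uncurry_sub {f : ℝ → ℝ} (hf : AEStronglyMeasurable f volume) (m : ℕ) :
    AEStronglyMeasurable (fun z : ℝ × ℝ => f (z.1 - z.2)) (periodMeasure.prod (vpMeasure m)) := by
  have := hf.comp_quasiMeasurePreserving
    (quasiMeasurePreserving_sub_of_right_invariant (volume : Measure ℝ) (volume : Measure ℝ))
  exact this.mono_ac
    (periodMeasure_absolutelyContinuous.prod (vpMeasure_absolutelyContinuous m))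

lemma exists_mul_vpMoment_le {L ε : ℝ≥0∞} (hL : L ≠ ∞) (hε : 0 < ε) :
    ∃ m : ℕ, L * ENNReal.ofReal ((1 / (2 * m + 2 : ℝ)) ^ (1 / 2 : ℝ)) ≤ ε := by
  have h1 : Filter.Tendsto (fun m : ℕ => (1 / (2 * m + 2 : ℝ)) ^ (1 / 2 : ℝ)) Filter.atTop
      (nhds 0) := by
    have h2 : Filter.Tendsto (fun m : ℕ => 1 / (2 * m + 2 : ℝ)) Filter.atTop (nhds 0) := by
      have := (tendsto_one_div_add_atTop_nhds_zero_nat (𝕜 := ℝ)).const_mul (1 / 2)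
      rw [mul_zero] at this
      refine this.congr fun m => ?_
      field_simp
    have := h2.rpow_const (p := 1 / 2) (Or.inr (by norm_num))
    rwa [zero_rpow (by norm_num)] at this
  have h3 := ENNReal.Tendsto.const_mul (a := L) (ENNReal.tendsto_ofReal h1)
    (Or.inr hL)
  rw [ENNReal.ofReal_zero, mul_zero] at h3
  obtain ⟨m, hm⟩ := (h3.eventually (eventually_lt_nhds hε)).exists
  exact ⟨m, hm.le⟩

/-- Approximation of a function with an integral Lipschitz condition by trigonometric polynomials,
respecting translation differences and positivity. -/
lemma exists_onCircle_approx {p : ℝ} (hp : 1 ≤ p) {f : ℝ → ℝ} (hf : Function.Periodic f (2 * π))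
    (hm : MemLp f (ENNReal.ofReal p) periodMeasure) {L : ℝ≥0}
    (hL : ∀ s, periodNorm p (fun x => f (x - s) - f x) ≤ L * ENNReal.ofReal |sin (s / 2)|)
    {ε : ℝ≥0∞} (hε : 0 < ε) :
    ∃ P : Polynomial ℂ, periodNorm p (fun x => (onCircle P x).re - f x) ≤ ε ∧
      (∀ h, periodNorm p (fun x => (onCircle P (x + h)).re - (onCircle P x).re) ≤
        periodNorm p (fun x => f (x + h) - f x)) ∧
      ((∀ x, 0 ≤ f x) → ∀ x, 0 ≤ (onCircle P x).re) := by
  have hp0 : 0 < p := by linarith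
  have hi : Integrable f periodMeasure := hm.integrable (by simpa using hp)
  have hmeas := aestronglyMeasurable_of_periodic hf hi
  obtain ⟨m, hmε⟩ := exists_mul_vpMoment_le
    (ENNReal.rpow_ne_top_of_nonneg hp0.le (ENNReal.coe_ne_top (r := L)))
    (ENNReal.rpow_pos_of_nonneg hε hp0.le)
  obtain ⟨P, hP⟩ := isTrigPoly_convolution hf hi (isTrigPoly_vpKernel m)
  have hP' : ∀ x, (onCircle P x).re = ∫ s, f (x - s) ∂vpMeasure m := fun x => by
    rw [← hP, integral_vpMeasure]
  have hint : ∀ x, Integrable (fun s => f (x - s)) (vpMeasure m) := fun x =>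
    integrable_vpMeasure (integrable_comp_sub hf hi x)
  refine ⟨P, ?_, fun h => ?_, fun h0 x => ?_⟩
  · have e : (fun x => (onCircle P x).re - f x) = fun x => ∫ s, (f (x - s) - f x) ∂vpMeasure m := by
      funext x
      rw [integral_sub (hint x) (integrable_const _), hP']
      simp
    have hfst : AEStronglyMeasurable (fun z : ℝ × ℝ => f z.1)
        (periodMeasure.prod (vpMeasure m)) := (hm.aestronglyMeasurable).comp_fst
    have h1 := periodNorm_integral_rpow_le hp (κ := vpMeasure m) (Φ := fun x s => f (x - s) - f x)
      ((aestronglyMeasurable_uncurry_sub hmeas m).sub hfst)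
    rw [e, ← ENNReal.rpow_le_rpow_iff hp0]
    refine h1.trans (le_trans ?_ hmε)
    calc ∫⁻ s, periodNorm p (fun x => f (x - s) - f x) ^ p ∂vpMeasure m
        ≤ ∫⁻ s, (L : ℝ≥0∞) ^ p * ENNReal.ofReal |sin (s / 2)| ∂vpMeasure m := by
          refine lintegral_mono fun s => ?_
          refine (ENNReal.rpow_le_rpow (hL s) hp0.le).trans ?_
          rw [ENNReal.mul_rpow_of_nonneg _ _ hp0.le]
          refine mul_le_mul_right ?_ _
          refine ENNReal.rpow_le_self_of_le_one ?_ hp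
          simpa using abs_sin_le_one (s / 2)
      _ = (L : ℝ≥0∞) ^ p * ∫⁻ s, ENNReal.ofReal |sin (s / 2)| ∂vpMeasure m :=
          lintegral_const_mul _ (by fun_prop)
      _ ≤ _ := mul_le_mul_right (lintegral_abs_sin_vpMeasure_le m) _
  · have e : (fun x => (onCircle P (x + h)).re - (onCircle P x).re) =
        fun x => ∫ s, (f (x - s + h) - f (x - s)) ∂vpMeasure m := by
      funext x
      have h1 := hint (x + h)
      simp only [add_sub_right_comm] at h1
      rw [integral_sub h1 (hint x), hP', hP']
      simp only [add_sub_right_comm]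
    have hmh : AEStronglyMeasurable (fun x => f (x + h) - f x) volume :=
      (hmeas.comp_quasiMeasurePreserving
        (measurePreserving_add_right volume h).quasiMeasurePreserving).sub hmeas
    have h1 := periodNorm_integral_rpow_le hp (κ := vpMeasure m)
      (Φ := fun x s => f (x - s + h) - f (x - s)) (aestronglyMeasurable_uncurry_sub hmh m)
    rw [e, ← ENNReal.rpow_le_rpow_iff hp0]
    refine h1.trans (le_of_eq ?_)
    have h2 : ∀ s, periodNorm p (fun x => f (x - s + h) - f (x - s)) =
        periodNorm p (fun x => f (x + h) - f x) := fun s => by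
      have hper : Function.Periodic (fun x => f (x + h) - f x) (2 * π) := fun x => by
        change f (x + 2 * π + h) - f (x + 2 * π) = f (x + h) - f x
        rw [add_right_comm, hf, hf]
      have := periodNorm_add_right hp0 hper (-s)
      simpa only [← sub_eq_add_neg] using this
    simp only [h2, lintegral_const, measure_univ, mul_one]
  · rw [hP']
    exact integral_nonneg fun s => h0 _

section PeriodNorm

variable {E F G : Type*} [NormedAddCommGroup E] [NormedAddCommGroup F] [NormedAddCommGroup G]

lemma periodNorm_le_add {p : ℝ} (hp : 1 ≤ p) {f : ℝ → E} {g : ℝ → F} {h : ℝ → G}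
    (hg : AEStronglyMeasurable g periodMeasure) (hh : AEStronglyMeasurable h periodMeasure)
    (hfgh : ∀ x, ‖f x‖ ≤ ‖g x‖ + ‖h x‖) : periodNorm p f ≤ periodNorm p g + periodNorm p h := by
  have h1 := eLpNorm_add_le hg.norm hh.norm (p := ENNReal.ofReal p) (by simpa using hp)
  rw [eLpNorm_norm, eLpNorm_norm] at h1
  refine le_trans (eLpNorm_mono fun x => ?_) h1
  rw [Pi.add_apply, Real.norm_of_nonneg (by positivity)]
  exact hfgh x

lemma periodNorm_le_of_bound {p C : ℝ} {f : ℝ → E} (h : ∀ x, ‖f x‖ ≤ C) :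
    periodNorm p f ≤ ENNReal.ofReal C := by
  have := eLpNorm_le_of_ae_bound (p := ENNReal.ofReal p) (μ := periodMeasure)
    (Filter.Eventually.of_forall h)
  simpa using this

lemma periodNorm_mono_exponent {p q : ℝ} (hpq : p ≤ q) {f : ℝ → E}
    (hf : AEStronglyMeasurable f periodMeasure) : periodNorm p f ≤ periodNorm q f :=
  eLpNorm_le_eLpNorm_of_exponent_le (ENNReal.ofReal_le_ofReal hpq) hf

end PeriodNorm

lemma exists_lipschitz_onCircle (P : Polynomial ℂ) :
    ∃ L : ℝ≥0, ∀ x s, ‖onCircle P (x - s) - onCircle P x‖ ≤ L * |sin (s / 2)| := by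
  obtain ⟨C, hC⟩ := (isCompact_closedBall (0 : ℂ) 1).exists_bound_of_continuousOn
    (P.derivative.continuous.continuousOn)
  have hC0 : 0 ≤ C := (norm_nonneg _).trans (hC 0 (by simp))
  refine ⟨⟨2 * C, by positivity⟩, fun x s => ?_⟩
  have h := Convex.norm_image_sub_le_of_norm_deriv_le (f := fun z => P.eval z) (𝕜 := ℂ)
    (s := Metric.closedBall 0 1) (C := C) (fun z _ => P.differentiable z)
    (fun z hz => by rw [Polynomial.deriv]; exact hC z hz) (convex_closedBall 0 1)
    (x := circleMap 0 1 x) (y := circleMap 0 1 (x - s)) (by simp) (by simp)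
  have h2 : ‖circleMap 0 1 (x - s) - circleMap 0 1 x‖ = 2 * |sin (s / 2)| := by
    have e : circleMap 0 1 (x - s) - circleMap 0 1 x =
        circleMap 0 1 x * (Complex.exp (Complex.I * ((-s : ℝ) : ℂ)) - 1) := by
      rw [circleMap_zero_one_sub, mul_sub, mul_one]
      congr 2
      simp [circleMap, mul_comm]
    rw [e, norm_mul, Complex.norm_exp_I_mul_ofReal_sub_one]
    simp [neg_div]
  rw [h2] at h
  refine h.trans (le_of_eq ?_)
  change C * (2 * |sin (s / 2)|) = 2 * C * |sin (s / 2)|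
  ring

/-- A nonnegative Lipschitz function of a trigonometric polynomial is approximated in `L^2` by
nonnegative trigonometric polynomials. -/
lemma exists_nonneg_approx_max (P : Polynomial ℂ) {ε : ℝ≥0∞} (hε : 0 < ε) (σ : ℝ) (hσ : |σ| = 1) :
    ∃ Q : Polynomial ℂ, periodNorm 2 (fun x => (onCircle Q x).re -
      max (σ * (onCircle P x).re) 0) ≤ ε ∧ ∀ x, 0 ≤ (onCircle Q x).re := by
  obtain ⟨L, hL⟩ := exists_lipschitz_onCircle P
  have hc : Continuous fun x => max (σ * (onCircle P x).re) 0 :=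
    ((Complex.continuous_re.comp (continuous_onCircle P)).const_mul σ).max continuous_const
  have hs : ∀ s, periodNorm 2 (fun x => max (σ * (onCircle P (x - s)).re) 0 -
      max (σ * (onCircle P x).re) 0) ≤ L * ENNReal.ofReal |sin (s / 2)| := by
    intro s
    refine (periodNorm_le_of_bound (C := L * |sin (s / 2)|) fun x => ?_).trans (le_of_eq ?_)
    · refine (abs_max_sub_max_le_abs _ _ _).trans (le_trans ?_ (hL x s))
      rw [← mul_sub, abs_mul, hσ, one_mul, ← Complex.sub_re]
      exact Complex.abs_re_le_norm _
    · rw [ENNReal.ofReal_mul (by positivity), ENNReal.ofReal_coe_nnreal]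
  obtain ⟨Q, h1, -, h3⟩ := exists_onCircle_approx (p := 2) one_le_two
    (f := fun x => max (σ * (onCircle P x).re) 0)
    (fun x => by simp only [onCircle_periodic P x]) (hc.memLp_periodMeasure _) hs hε
  exact ⟨Q, h1, h3 fun x => le_max_right _ _⟩

lemma continuous_re_onCircle (P : Polynomial ℂ) : Continuous fun x => (onCircle P x).re :=
  Complex.continuous_re.comp (continuous_onCircle P)

lemma continuous_im_onCircle (P : Polynomial ℂ) : Continuous fun x => (onCircle P x).im :=
  Complex.continuous_im.comp (continuous_onCircle P)

/-- M. Riesz's inequality for conjugation, with exponent `1 < p ≤ 2`. -/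
lemma exists_periodNorm_im_le_of_le_two {p : ℝ} (hp : 1 < p) (hp2 : p ≤ 2) :
    ∃ C : ℝ≥0, ∀ P : Polynomial ℂ, (P.eval 0).im = 0 →
      periodNorm p (fun x => (onCircle P x).im) ≤ C * periodNorm p (fun x => (onCircle P x).re) := by
  obtain ⟨A, B, hA, hB, hAB⟩ := exists_abs_im_rpow_le hp hp2
  have hp0 : 0 < p := by linarith
  set c : ℝ≥0 := (A ^ (1 / p)).toNNReal with hc
  have hcpos : ENNReal.ofReal (A ^ (1 / p)) = c := rfl
  refine ⟨2 * c, fun P hP => ?_⟩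
  set u : ℝ → ℝ := fun x => (onCircle P x).re with hu
  have hucont : Continuous u := continuous_re_onCircle P
  refine ENNReal.le_of_forall_pos_le_add fun η hη _ => ?_
  set e : ℝ≥0 := η / (2 + 4 * c) with he
  have he0 : 0 < e := by positivity
  have hone : ∀ σ : ℝ, |σ| = 1 → ∃ R : Polynomial ℂ, (R.eval 0).im = 0 ∧
      periodNorm 2 (fun x => (onCircle R x).re - e - max (σ * u x) 0) ≤ e ∧
      periodNorm p (fun x => (onCircle R x).im) ≤ c * (periodNorm p u + 2 * e) := by
    intro σ hσ
    obtain ⟨Q, h1, h2⟩ := exists_nonneg_approx_max P (ε := e) (by simpa using he0) σ hσ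
    set R : Polynomial ℂ := Q + Polynomial.C ((e : ℝ) - (Q.eval 0).im * Complex.I) with hR
    have hRre : ∀ x, (onCircle R x).re = (onCircle Q x).re + e := fun x => by
      rw [hR, onCircle_add, onCircle_C]; simp
    have hR0 : (R.eval 0).im = 0 := by simp [hR]
    have h1' : periodNorm 2 (fun x => (onCircle R x).re - e - max (σ * u x) 0) ≤ e := by
      simpa only [hRre, add_sub_cancel_right] using h1
    refine ⟨R, hR0, h1', ?_⟩
    have hint := integral_abs_im_rpow_le_of_pos hp hB hAB (P := R) (δ := e) he0
      (fun x => by rw [hRre]; linarith [h2 x]) hR0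
    have h3 := periodNorm_le_of_integral_le hp0 hA (continuous_im_onCircle R)
      (continuous_re_onCircle R) hint
    rw [hcpos] at h3
    refine h3.trans (mul_le_mul_right ?_ _)
    have hd : Continuous fun x => (onCircle R x).re - e - max (σ * u x) 0 :=
      ((continuous_re_onCircle R).sub continuous_const).sub
        ((hucont.const_mul σ).max continuous_const)
    have hde : Continuous fun x => |(onCircle R x).re - e - max (σ * u x) 0| + (e : ℝ) :=
      hd.abs.add continuous_const
    have h4 : periodNorm p (fun x => (onCircle R x).re) ≤ periodNorm p u +
        periodNorm p (fun x => |(onCircle R x).re - e - max (σ * u x) 0| + (e : ℝ)) := by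
      refine periodNorm_le_add hp.le hucont.aestronglyMeasurable hde.aestronglyMeasurable
        fun x => ?_
      have hm : |max (σ * u x) 0| ≤ |u x| := by
        have := abs_max_sub_max_le_abs (σ * u x) 0 0
        simpa [abs_mul, hσ] using this
      simp only [Real.norm_eq_abs]
      rw [abs_of_nonneg (by positivity : 0 ≤ |(onCircle R x).re - e - max (σ * u x) 0| + (e : ℝ))]
      have h5 := abs_add_three ((onCircle R x).re - e - max (σ * u x) 0) (e : ℝ) (max (σ * u x) 0)
      rw [abs_of_nonneg e.coe_nonneg] at h5
      have h6 : (onCircle R x).re - e - max (σ * u x) 0 + e + max (σ * u x) 0 =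
        (onCircle R x).re := by ring
      rw [h6] at h5
      linarith
    have h7 : periodNorm p (fun x => |(onCircle R x).re - e - max (σ * u x) 0| + (e : ℝ)) ≤
        e + e := by
      refine (periodNorm_le_add hp.le hd.aestronglyMeasurable
        (h := fun _ => (e : ℝ)) aestronglyMeasurable_const fun x => ?_).trans
        (add_le_add ((periodNorm_mono_exponent hp2 hd.aestronglyMeasurable).trans h1') ?_)
      · refine (norm_add_le _ _).trans (le_of_eq ?_)
        rw [norm_abs_eq_norm]
      · refine (periodNorm_le_of_bound (C := e) fun x => ?_).trans (by simp)
        simp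
    rw [two_mul]
    exact h4.trans (by gcongr)
  obtain ⟨R₁, h01, hd1, hb1⟩ := hone 1 (by simp)
  obtain ⟨R₂, h02, hd2, hb2⟩ := hone (-1) (by simp)
  set Q : Polynomial ℂ := P - (R₁ - R₂) with hQ
  have hQ0 : (Q.eval 0).im = 0 := by simp [hQ, hP, h01, h02]
  have hQ2 : periodNorm 2 (fun x => (onCircle Q x).im) ≤
      periodNorm 2 (fun x => (onCircle Q x).re) := by
    have := periodNorm_le_of_integral_le (p := 2) two_pos zero_le_one (continuous_im_onCircle Q)
      (continuous_re_onCircle Q) (integral_im_sq_le hQ0)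
    simpa using this
  have hcd : ∀ (R : Polynomial ℂ) (σ : ℝ),
      Continuous fun x => (onCircle R x).re - e - max (σ * u x) 0 := fun R σ =>
    ((continuous_re_onCircle R).sub continuous_const).sub
      ((hucont.const_mul σ).max continuous_const)
  have hQre : periodNorm 2 (fun x => (onCircle Q x).re) ≤ e + e := by
    refine (periodNorm_le_add one_le_two (hcd R₁ 1).aestronglyMeasurable
      (hcd R₂ (-1)).aestronglyMeasurable fun x => ?_).trans (add_le_add hd1 hd2)
    have h8 : (onCircle Q x).re = ((onCircle R₂ x).re - e - max (-1 * u x) 0) -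
        ((onCircle R₁ x).re - e - max (1 * u x) 0) := by
      have h9 : max (1 * u x) 0 - max (-1 * u x) 0 = u x := by
        rw [one_mul, neg_one_mul]; exact max_zero_sub_max_neg_zero_eq_self (u x)
      simp only [hQ, onCircle_sub, Complex.sub_re]
      have h10 : (onCircle P x).re = u x := rfl
      linarith
    rw [h8, add_comm]
    exact norm_sub_le _ _
  have hQp : periodNorm p (fun x => (onCircle Q x).im) ≤ e + e :=
    (periodNorm_mono_exponent hp2 (continuous_im_onCircle Q).aestronglyMeasurable).trans
      (hQ2.trans hQre)
  have hsplit : periodNorm p (fun x => (onCircle P x).im) ≤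
      periodNorm p (fun x => (onCircle Q x).im) + (periodNorm p (fun x => (onCircle R₁ x).im) +
        periodNorm p (fun x => (onCircle R₂ x).im)) := by
    have hc12 : Continuous fun x => (onCircle R₁ x).im - (onCircle R₂ x).im :=
      (continuous_im_onCircle R₁).sub (continuous_im_onCircle R₂)
    refine (periodNorm_le_add hp.le (continuous_im_onCircle Q).aestronglyMeasurable
      hc12.aestronglyMeasurable fun x => ?_).trans (add_le_add le_rfl
        (periodNorm_le_add hp.le (continuous_im_onCircle R₁).aestronglyMeasurable
          (continuous_im_onCircle R₂).aestronglyMeasurable fun x => norm_sub_le _ _))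
    refine le_trans (le_of_eq ?_) (norm_add_le _ _)
    congr 1
    simp [hQ, onCircle_sub]
  calc periodNorm p (fun x => (onCircle P x).im)
      ≤ (e + e) + (c * (periodNorm p u + 2 * e) + c * (periodNorm p u + 2 * e)) :=
        hsplit.trans (add_le_add hQp (add_le_add hb1 hb2))
    _ = 2 * c * periodNorm p u + ((2 + 4 * c) * e : ℝ≥0) := by push_cast; ring
    _ = ((2 * c : ℝ≥0) : ℝ≥0∞) * periodNorm p u + η := by
        have : (2 + 4 * c) * e = η := by
          rw [he]; exact mul_div_cancel₀ _ (by positivity)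
        rw [this]; push_cast; rfl

lemma periodNorm_sq {p : ℝ} (hp : 0 < p) (g : ℝ → ℝ) :
    periodNorm p (fun x => g x ^ 2) = periodNorm (2 * p) g ^ 2 := by
  have h := eLpNorm_norm_rpow (p := ENNReal.ofReal p) (μ := periodMeasure) g two_pos
  rw [← ENNReal.ofReal_mul hp.le, mul_comm p 2] at h
  rw [periodNorm, ← ENNReal.rpow_ofNat, ← h]
  congr 1
  ext x
  simp

lemma periodNorm_const_mul {p : ℝ} (c : ℝ≥0) (g : ℝ → ℝ) :
    periodNorm p (fun x => c * g x) = c * periodNorm p g := by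
  have h := eLpNorm_const_smul (c : ℝ) g (ENNReal.ofReal p) periodMeasure
  rw [Real.enorm_of_nonneg c.coe_nonneg, ENNReal.ofReal_coe_nnreal] at h
  exact h

/-- Cotlar's doubling argument: the identity `(u + iv)² = u² - v² + 2iuv` transfers the conjugate
function inequality from exponent `p` to exponent `2p`. -/
lemma periodNorm_im_le_double {p : ℝ} (hp : 1 < p) {C : ℝ≥0}
    (hC : ∀ P : Polynomial ℂ, P.eval 0 = 0 →
      periodNorm p (fun x => (onCircle P x).im) ≤ C * periodNorm p (fun x => (onCircle P x).re))
    (P : Polynomial ℂ) (hP : P.eval 0 = 0) :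
    periodNorm (2 * p) (fun x => (onCircle P x).im) ≤
      (2 + 2 * C : ℝ≥0) * periodNorm (2 * p) (fun x => (onCircle P x).re) := by
  have hp0 : 0 < p := by linarith
  set u : ℝ → ℝ := fun x => (onCircle P x).re with hu
  set v : ℝ → ℝ := fun x => (onCircle P x).im with hv
  have hcu : Continuous u := continuous_re_onCircle P
  have hcv : Continuous v := continuous_im_onCircle P
  have hfin : periodNorm p (fun x => v x ^ 2) ≠ ∞ :=
    ((hcv.pow 2).memLp_periodMeasure _).eLpNorm_ne_top
  have hsq : ∀ x, onCircle (Polynomial.C (-Complex.I) * (P * P)) x =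
      ⟨2 * u x * v x, v x ^ 2 - u x ^ 2⟩ := by
    intro x
    rw [onCircle_mul, onCircle_mul, onCircle_C]
    apply Complex.ext <;> simp [hu, hv] <;> ring
  have h1 := hC (Polynomial.C (-Complex.I) * (P * P)) (by simp [hP])
  simp only [hsq] at h1
  have h2 : periodNorm p (fun x => v x ^ 2) ≤
      periodNorm p (fun x => v x ^ 2 - u x ^ 2) + periodNorm p (fun x => u x ^ 2) := by
    refine periodNorm_le_add hp.le ((hcv.pow 2).sub (hcu.pow 2)).aestronglyMeasurable
      (hcu.pow 2).aestronglyMeasurable fun x => ?_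
    have := norm_add_le (v x ^ 2 - u x ^ 2) (u x ^ 2)
    rwa [sub_add_cancel] at this
  have h3 : C * periodNorm p (fun x => 2 * u x * v x) ≤
      (1 / 2 : ℝ≥0) * periodNorm p (fun x => v x ^ 2) +
        (2 * C ^ 2 : ℝ≥0) * periodNorm p (fun x => u x ^ 2) := by
    rw [← periodNorm_const_mul, ← periodNorm_const_mul, ← periodNorm_const_mul]
    refine periodNorm_le_add hp.le (continuous_const.mul (hcv.pow 2)).aestronglyMeasurable
      (continuous_const.mul (hcu.pow 2)).aestronglyMeasurable fun x => ?_
    rw [Real.norm_eq_abs, Real.norm_of_nonneg (by positivity), Real.norm_of_nonneg (by positivity)]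
    push_cast
    exact abs_le.2 ⟨by nlinarith [sq_nonneg (v x + 2 * C * u x)],
      by nlinarith [sq_nonneg (v x - 2 * C * u x)]⟩
  have h4 : periodNorm p (fun x => v x ^ 2) ≤
      (2 + 4 * C ^ 2 : ℝ≥0) * periodNorm p (fun x => u x ^ 2) := by
    have hfinu : periodNorm p (fun x => u x ^ 2) ≠ ∞ :=
      ((hcu.pow 2).memLp_periodMeasure _).eLpNorm_ne_top
    have h5 := h2.trans (add_le_add (h1.trans h3) le_rfl)
    lift periodNorm p (fun x => u x ^ 2) to ℝ≥0 using hfinu with U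
    lift periodNorm p (fun x => v x ^ 2) to ℝ≥0 using hfin with V
    norm_cast at h5 ⊢
    rw [← NNReal.coe_le_coe] at h5 ⊢
    push_cast at h5 ⊢
    linarith
  rw [periodNorm_sq hp0, periodNorm_sq hp0] at h4
  rw [← ENNReal.pow_le_pow_left_iff two_ne_zero, mul_pow]
  refine h4.trans (mul_le_mul_left ?_ _)
  norm_cast
  rw [← NNReal.coe_le_coe]
  push_cast
  nlinarith [C.coe_nonneg]

/-- M. Riesz's inequality for conjugation. -/
lemma exists_periodNorm_im_le {p : ℝ} (hp : 1 < p) :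
    ∃ C : ℝ≥0, ∀ P : Polynomial ℂ, P.eval 0 = 0 →
      periodNorm p (fun x => (onCircle P x).im) ≤ C * periodNorm p (fun x => (onCircle P x).re) := by
  obtain ⟨n, hn⟩ := pow_unbounded_of_one_lt p (one_lt_two (α := ℝ))
  induction n generalizing p with
  | zero => rw [pow_zero] at hn; linarith
  | succ n ih =>
    rcases le_or_gt p 2 with h2 | h2
    · obtain ⟨C, hC⟩ := exists_periodNorm_im_le_of_le_two hp h2
      exact ⟨C, fun P hP => hC P (by simp [hP])⟩
    · obtain ⟨C, hC⟩ := ih (p := p / 2) (by linarith) (by rw [pow_succ] at hn; linarith)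
      refine ⟨2 + 2 * C, fun P hP => ?_⟩
      have := periodNorm_im_le_double (by linarith) hC P hP
      rwa [mul_div_cancel₀ p two_ne_zero] at this

lemma exists_periodNorm_onCircle_le_re {p : ℝ} (hp : 1 < p) :
    ∃ C : ℝ≥0, ∀ P : Polynomial ℂ, P.eval 0 = 0 →
      periodNorm p (onCircle P) ≤ C * periodNorm p (fun x => (onCircle P x).re) := by
  obtain ⟨C, hC⟩ := exists_periodNorm_im_le hp
  refine ⟨1 + C, fun P hP => ?_⟩
  push_cast
  rw [add_mul, one_mul]
  exact (periodNorm_le_add hp.le (continuous_re_onCircle P).aestronglyMeasurable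
    (continuous_im_onCircle P).aestronglyMeasurable
    fun x => Complex.norm_le_abs_re_add_abs_im _).trans (add_le_add le_rfl (hC P hP))

/-- The truncation of a polynomial to its terms of degree less than `m`. -/
noncomputable def truncate (m : ℕ) (P : Polynomial ℂ) : Polynomial ℂ :=
  ∑ j ∈ range m, Polynomial.monomial j (P.coeff j)

lemma coeff_truncate (m : ℕ) (P : Polynomial ℂ) (j : ℕ) :
    (truncate m P).coeff j = if j < m then P.coeff j else 0 := by
  simp [truncate, Polynomial.coeff_monomial]

lemma onCircle_truncate (m : ℕ) (P : Polynomial ℂ) (x : ℝ) :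
    onCircle (truncate m P) x = ∑ j ∈ range m, P.coeff j * circleMap 0 1 x ^ j := by
  simp [onCircle, truncate, Polynomial.eval_finsetSum]

lemma truncate_of_natDegree_lt {m : ℕ} {P : Polynomial ℂ} (h : P.natDegree < m) :
    truncate m P = P :=
  (Polynomial.as_sum_range' P m h).symm

lemma exists_eq_truncate_add (m : ℕ) (P : Polynomial ℂ) :
    ∃ R : Polynomial ℂ, P = truncate m P + Polynomial.X ^ m * R := by
  obtain ⟨R, hR⟩ := (Polynomial.X_pow_dvd_iff (f := P - truncate m P) (n := m)).2
    fun d hd => by simp [coeff_truncate, hd]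
  exact ⟨R, by rw [← hR, add_sub_cancel]⟩

lemma circleMap_mul_conj (x : ℝ) : circleMap 0 1 x * conj (circleMap 0 1 x) = 1 := by
  rw [Complex.mul_conj, Complex.normSq_eq_norm_sq]
  simp

lemma exists_reflection_truncate (m : ℕ) (P : Polynomial ℂ) :
    ∃ Q : Polynomial ℂ, Q.eval 0 = 0 ∧
      ∀ x, onCircle Q x = circleMap 0 1 x ^ m * conj (onCircle (truncate m P) x) := by
  refine ⟨∑ j ∈ range m, Polynomial.monomial (m - j) (conj (P.coeff j)), ?_, fun x => ?_⟩
  · rw [Polynomial.eval_finsetSum]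
    refine sum_eq_zero fun j hj => ?_
    rw [Polynomial.eval_monomial, zero_pow (Nat.sub_ne_zero_of_lt (mem_range.1 hj)), mul_zero]
  · rw [onCircle_truncate, onCircle, Polynomial.eval_finsetSum, map_sum, mul_sum]
    refine sum_congr rfl fun j hj => ?_
    have hj' : m = (m - j) + j := by have := mem_range.1 hj; omega
    have h1 := circleMap_mul_conj x
    rw [Polynomial.eval_monomial, map_mul, map_pow]
    nth_rewrite 2 [hj']
    rw [pow_add]
    have h2 : circleMap 0 1 x ^ j * conj (circleMap 0 1 x) ^ j = 1 := by
      rw [← mul_pow, h1, one_pow]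
    linear_combination -(conj (P.coeff j) * circleMap 0 1 x ^ (m - j)) * h2

/-- Truncation of analytic polynomials is bounded in `L^p` for `1 < p < ∞`, uniformly in the
degree of truncation. -/
lemma exists_periodNorm_truncate_le {p : ℝ} (hp : 1 < p) :
    ∃ C : ℝ≥0, ∀ (P : Polynomial ℂ) (m : ℕ),
      periodNorm p (onCircle (truncate m P)) ≤ C * periodNorm p (onCircle P) := by
  obtain ⟨C, hC⟩ := exists_periodNorm_onCircle_le_re hp
  refine ⟨4 * C, fun P m => ?_⟩
  obtain ⟨R, hR⟩ := exists_eq_truncate_add m P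
  obtain ⟨Q, hQ0, hQ⟩ := exists_reflection_truncate m P
  set w : ℝ → ℂ := fun x => conj (onCircle Q x) + onCircle R x with hw
  set r : ℂ := R.eval 0 with hr
  have hcw : Continuous w :=
    (Complex.continuous_conj.comp (continuous_onCircle Q)).add (continuous_onCircle R)
  have hwP : ∀ x, onCircle P x = circleMap 0 1 x ^ m * w x := by
    intro x
    have h2 : circleMap 0 1 x ^ m * conj (circleMap 0 1 x) ^ m = 1 := by
      rw [← mul_pow, circleMap_mul_conj, one_pow]
    have hX : onCircle (Polynomial.X ^ m) x = circleMap 0 1 x ^ m := by simp [onCircle]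
    rw [hR, onCircle_add, onCircle_mul, hX]
    simp only [hw, hQ, map_mul, map_pow, Complex.conj_conj]
    linear_combination -(onCircle (truncate m P) x) * h2
  have hnw : periodNorm p w = periodNorm p (onCircle P) :=
    eLpNorm_congr_norm_ae (Filter.Eventually.of_forall fun x => by rw [hwP]; simp)
  have hint : ∫ x, w x ∂periodMeasure = r := by
    have h1 : Integrable (fun x => conj (onCircle Q x)) periodMeasure :=
      (Complex.continuous_conj.comp (continuous_onCircle Q)).integrable_periodMeasure
    rw [integral_add h1 (continuous_onCircle R).integrable_periodMeasure, integral_conj,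
      integral_onCircle, integral_onCircle, hQ0, map_zero, zero_add]
  have hrn : ‖r‖ₑ ≤ periodNorm p (onCircle P) := by
    rw [← hint, ← hnw]
    refine (enorm_integral_le_lintegral_enorm _).trans ?_
    rw [← eLpNorm_one_eq_lintegral_enorm]
    exact eLpNorm_le_eLpNorm_of_exponent_le (by simpa using hp.le) hcw.aestronglyMeasurable
  have hconst : periodNorm p (fun _ => r) ≤ periodNorm p (onCircle P) := by
    refine le_trans ?_ hrn
    have := periodNorm_le_of_bound (p := p) (C := ‖r‖) (f := fun _ : ℝ => r) fun x => le_rfl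
    rwa [ofReal_norm] at this
  have key : ∀ M : Polynomial ℂ, M.eval 0 = 0 → (∀ x, |(onCircle M x).re| ≤ ‖w x - r‖) →
      periodNorm p (onCircle M) ≤ C * (2 * periodNorm p (onCircle P)) := by
    intro M hM hMw
    refine (hC M hM).trans (mul_le_mul_right ?_ _)
    rw [two_mul]
    refine (periodNorm_le_add hp.le hcw.aestronglyMeasurable (h := fun _ => r)
      aestronglyMeasurable_const fun x => (hMw x).trans (norm_sub_le _ _)).trans
      (add_le_add hnw.le hconst)
  have h1 := key (R - Polynomial.C r + Q) (by simp [hQ0, hr]) fun x => by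
    refine le_trans (le_of_eq ?_) (Complex.abs_re_le_norm _)
    congr 1
    simp only [onCircle_add, onCircle_sub, onCircle_C, hw, Complex.add_re, Complex.sub_re,
      Complex.conj_re]
    ring
  have h2 := key (Polynomial.C Complex.I * (R - Polynomial.C r - Q)) (by simp [hQ0, hr])
    fun x => by
      refine le_trans (le_of_eq ?_) (Complex.abs_im_le_norm _)
      rw [← abs_neg]
      congr 1
      simp only [onCircle_sub, onCircle_mul, onCircle_C, hw, Complex.add_im, Complex.sub_im,
        Complex.conj_im, Complex.mul_re, Complex.I_re, Complex.I_im]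
      ring
  refine (periodNorm_le_add hp.le (continuous_onCircle _).aestronglyMeasurable
    (continuous_onCircle _).aestronglyMeasurable fun x => ?_).trans
    ((add_le_add h1 h2).trans (le_of_eq (by push_cast; ring)))
  have h3 : ‖onCircle (truncate m P) x‖ = ‖onCircle Q x‖ := by rw [hQ]; simp
  have h4 : onCircle (R - Polynomial.C r + Q) x +
      Complex.I * onCircle (Polynomial.C Complex.I * (R - Polynomial.C r - Q)) x =
      2 * onCircle Q x := by
    simp only [onCircle_add, onCircle_sub, onCircle_mul, onCircle_C]
    linear_combination (onCircle R x - r - onCircle Q x) * Complex.I_mul_I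
  have h5 := norm_add_le (onCircle (R - Polynomial.C r + Q) x)
    (Complex.I * onCircle (Polynomial.C Complex.I * (R - Polynomial.C r - Q)) x)
  rw [h4, norm_mul, norm_mul, Complex.norm_I, one_mul, RCLike.norm_ofNat] at h5
  rw [h3]
  linarith [norm_nonneg (onCircle Q x)]

lemma integral_onCircle_mul_conj_pow (P : Polynomial ℂ) (m : ℕ) :
    ∫ x, onCircle P x * conj (circleMap 0 1 x) ^ m ∂periodMeasure = P.coeff m := by
  obtain ⟨R, hR⟩ := exists_eq_truncate_add m P
  obtain ⟨Q, hQ0, hQ⟩ := exists_reflection_truncate m P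
  have hPw : ∀ x, onCircle P x * conj (circleMap 0 1 x) ^ m =
      conj (onCircle Q x) + onCircle R x := by
    intro x
    have h2 : circleMap 0 1 x ^ m * conj (circleMap 0 1 x) ^ m = 1 := by
      rw [← mul_pow, circleMap_mul_conj, one_pow]
    have hX : onCircle (Polynomial.X ^ m) x = circleMap 0 1 x ^ m := by simp [onCircle]
    conv_lhs => rw [hR, onCircle_add, onCircle_mul, hX]
    simp only [hQ, map_mul, map_pow, Complex.conj_conj]
    linear_combination onCircle R x * h2
  have h1 : Integrable (fun x => conj (onCircle Q x)) periodMeasure :=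
    (Complex.continuous_conj.comp (continuous_onCircle Q)).integrable_periodMeasure
  simp only [hPw]
  rw [integral_add h1 (continuous_onCircle R).integrable_periodMeasure, integral_conj,
    integral_onCircle, integral_onCircle, hQ0, map_zero, zero_add, hR]
  simp [coeff_truncate, Polynomial.coeff_X_pow_mul', Polynomial.coeff_zero_eq_eval_zero]

lemma integral_re_onCircle_mul_cos (P : Polynomial ℂ) (x : ℝ) {m : ℕ} (hm : m ≠ 0) :
    ∫ t, (onCircle P t).re * (2 * cos (m * (x - t))) ∂periodMeasure =
      (P.coeff m * circleMap 0 1 x ^ m).re := by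
  have hz : Continuous fun t : ℝ => circleMap 0 1 t := by fun_prop
  have hi1 : Integrable (fun t => circleMap 0 1 x ^ m *
      (onCircle P t * conj (circleMap 0 1 t) ^ m)) periodMeasure :=
    (continuous_const.mul ((continuous_onCircle P).mul
      ((Complex.continuous_conj.comp hz).pow m))).integrable_periodMeasure
  have hi2 : Integrable (fun t => conj (circleMap 0 1 x) ^ m *
      onCircle (P * Polynomial.X ^ m) t) periodMeasure :=
    (continuous_const.mul (continuous_onCircle _)).integrable_periodMeasure
  have hpt : ∀ t, (onCircle P t).re * (2 * cos (m * (x - t))) =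
      (circleMap 0 1 x ^ m * (onCircle P t * conj (circleMap 0 1 t) ^ m) +
        conj (circleMap 0 1 x) ^ m * onCircle (P * Polynomial.X ^ m) t).re := by
    intro t
    have hX : onCircle (Polynomial.X ^ m) t = circleMap 0 1 t ^ m := by simp [onCircle]
    have h3 : circleMap 0 1 x ^ m * conj (circleMap 0 1 t) ^ m =
        circleMap 0 1 (m * (x - t)) := by
      simp only [circleMap, zero_add, Complex.ofReal_one, one_mul, ← Complex.exp_conj, map_mul,
        Complex.conj_ofReal, Complex.conj_I, ← Complex.exp_nat_mul, ← Complex.exp_add]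
      congr 1
      push_cast
      ring
    have h4 : conj (circleMap 0 1 x) ^ m * circleMap 0 1 t ^ m =
        conj (circleMap 0 1 (m * (x - t))) := by
      rw [← h3]; simp
    have h5 : circleMap 0 1 x ^ m * (onCircle P t * conj (circleMap 0 1 t) ^ m) +
        conj (circleMap 0 1 x) ^ m * onCircle (P * Polynomial.X ^ m) t =
        onCircle P t * ((2 * cos (m * (x - t)) : ℝ) : ℂ) := by
      rw [onCircle_mul, hX, ← circleMap_re, ← Complex.add_conj, ← h4, ← h3]
      ring
    rw [h5, Complex.re_mul_ofReal]
  simp only [hpt]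
  have h6 := integral_re (hi1.add hi2)
  simp only [Pi.add_apply, RCLike.re_to_complex] at h6
  rw [h6, integral_add hi1 hi2, integral_const_mul, integral_const_mul,
    integral_onCircle_mul_conj_pow, integral_onCircle]
  simp [hm, mul_comm]

lemma partialFourierSum_eq_integral (f : ℝ → ℝ) (k : ℕ) (x : ℝ) :
    partialFourierSum f k x =
      ∫ t, f t * (1 + ∑ j ∈ Icc 1 k, 2 * cos (j * (x - t))) ∂periodMeasure := by
  rw [integral_periodMeasure, partialFourierSum, smul_eq_mul]
  have : ∀ t, f t * (1 + ∑ j ∈ Icc 1 k, 2 * cos (j * (x - t))) =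
      2 * (f t * dirichletKernel k (x - t)) := by
    intro t
    rw [dirichletKernel, ← mul_sum]
    ring
  simp only [this]
  rw [intervalIntegral.integral_const_mul]
  field_simp

lemma partialFourierSum_re_onCircle (P : Polynomial ℂ) (k : ℕ) (x : ℝ) :
    partialFourierSum (fun t => (onCircle P t).re) k x = (onCircle (truncate (k + 1) P) x).re := by
  rw [partialFourierSum_eq_integral]
  simp only [mul_add, mul_one, mul_sum]
  have hc : ∀ j : ℕ, Continuous fun t => (onCircle P t).re * (2 * cos (j * (x - t))) := fun j =>
    (continuous_re_onCircle P).mul (by fun_prop)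
  rw [integral_add (continuous_re_onCircle P).integrable_periodMeasure
    (integrable_finsetSum _ fun j _ => (hc j).integrable_periodMeasure),
    integral_finsetSum _ fun j _ => (hc j).integrable_periodMeasure]
  have h0 : ∫ t, (onCircle P t).re ∂periodMeasure = (P.coeff 0).re := by
    have := integral_re (continuous_onCircle P).integrable_periodMeasure
    simp only [RCLike.re_to_complex] at this
    rw [this, integral_onCircle, Polynomial.coeff_zero_eq_eval_zero]
  rw [h0, sum_congr rfl fun j hj => integral_re_onCircle_mul_cos P x
    (Nat.one_le_iff_ne_zero.1 (mem_Icc.1 hj).1), onCircle_truncate, sum_range_succ']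
  simp only [Complex.add_re, Complex.re_sum, pow_zero, mul_one]
  have h1 : Icc 1 k = Ico (0 + 1) (k + 1) := by ext j; simp
  rw [add_comm, h1, ← sum_Ico_add' (fun j => (P.coeff j * circleMap 0 1 x ^ j).re),
    ← range_eq_Ico]

lemma hasDerivAt_onCircle (P : Polynomial ℂ) (x : ℝ) :
    HasDerivAt (onCircle P)
      (onCircle (Polynomial.C Complex.I * (Polynomial.X * P.derivative)) x) x := by
  have h := (P.hasDerivAt (circleMap 0 1 x)).comp x (hasDerivAt_circleMap 0 1 x)
  refine h.congr_deriv ?_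
  simp only [onCircle_mul, onCircle_C, onCircle_X]
  rw [onCircle]
  ring

lemma periodNorm_deriv_le {p : ℝ} {P : Polynomial ℂ} {L : ℝ≥0}
    (hL : ∀ h, periodNorm p (fun x => (onCircle P (x + h)).re - (onCircle P x).re) ≤
      L * ENNReal.ofReal |h|) :
    periodNorm p (fun x => (onCircle (Polynomial.C Complex.I *
      (Polynomial.X * P.derivative)) x).re) ≤ L := by
  set F : ℕ → ℝ → ℝ := fun m x => ((m : ℝ≥0) + 1 : ℝ≥0) *
    ((onCircle P (x + 1 / ((m : ℝ) + 1))).re - (onCircle P x).re) with hF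
  have hlim : ∀ x, Filter.Tendsto (fun m => F m x) Filter.atTop
      (nhds (onCircle (Polynomial.C Complex.I * (Polynomial.X * P.derivative)) x).re) := by
    intro x
    have hd := (hasDerivAt_onCircle P x).tendsto_slope_zero_right
    have h1 : Filter.Tendsto (fun m : ℕ => 1 / ((m : ℝ) + 1)) Filter.atTop
        (nhdsWithin 0 (Set.Ioi 0)) :=
      tendsto_nhdsWithin_iff.2 ⟨tendsto_one_div_add_atTop_nhds_zero_nat,
        Filter.Eventually.of_forall fun m => by
          have : (0 : ℝ) < 1 / ((m : ℝ) + 1) := by positivity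
          exact this⟩
    have h2 := (Complex.continuous_re.tendsto _).comp (hd.comp h1)
    refine h2.congr fun m => ?_
    simp [hF]
  refine (Lp.eLpNorm_lim_le_liminf_eLpNorm (f := F) (fun m => ?_) _
    (Filter.Eventually.of_forall hlim)).trans ?_
  · have hc : Continuous (F m) := continuous_const.mul
      (((continuous_re_onCircle P).comp (by fun_prop)).sub (continuous_re_onCircle P))
    exact hc.aestronglyMeasurable
  · refine Filter.liminf_le_of_frequently_le' (Filter.Frequently.of_forall fun m => ?_)
    have h3 := periodNorm_const_mul (p := p) ((m : ℝ≥0) + 1)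
      (fun x => (onCircle P (x + 1 / ((m : ℝ) + 1))).re - (onCircle P x).re)
    refine h3.le.trans ((mul_le_mul_right (hL _) _).trans (le_of_eq ?_))
    have h4 : ENNReal.ofReal |1 / ((m : ℝ) + 1)| = ((1 / ((m : ℝ≥0) + 1) : ℝ≥0) : ℝ≥0∞) := by
      rw [abs_of_nonneg (by positivity), ← ENNReal.ofReal_coe_nnreal]
      push_cast
      rfl
    rw [h4]
    norm_cast
    field_simp

lemma rowMean_of_le {a : ℕ → ℕ → ℝ} {n m : ℕ} (hzero : ∀ k, n < k → a n k = 0)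
    (hsum : ∑ k ∈ range (n + 1), a n k = 1) (hm : n ≤ m) : rowMean a n m = 1 / ((m : ℝ) + 1) := by
  have h : ∑ k ∈ range (m + 1), a n k = 1 := by
    rw [← hsum]
    refine (sum_subset (range_subset_range.2 (by omega)) fun k _ hk => hzero k ?_).symm
    rw [mem_range] at hk
    omega
  rw [rowMean, h, mul_one]

lemma variation_rowMean_le {a : ℕ → ℕ → ℝ} {n m : ℕ} (hzero : ∀ k, n < k → a n k = 0)
    (hsum : ∑ k ∈ range (n + 1), a n k = 1) (hm : n ≤ m) :
    ∑ k ∈ range m, |rowMean a n (k + 1) - rowMean a n k| + |rowMean a n m| ≤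
      ∑ k ∈ range n, |rowMean a n k - rowMean a n (k + 1)| + 1 / ((n : ℝ) + 1) := by
  induction m, hm using Nat.le_induction with
  | base =>
    rw [rowMean_of_le hzero hsum le_rfl, abs_of_nonneg (by positivity)]
    simp only [abs_sub_comm]
    exact le_rfl
  | succ m hm ih =>
    refine le_trans (le_of_eq ?_) ih
    rw [sum_range_succ, add_assoc]
    congr 1
    rw [rowMean_of_le hzero hsum hm, rowMean_of_le hzero hsum (hm.trans (Nat.le_succ m))]
    have h1 : (0 : ℝ) < 1 / ((m + 1 : ℕ) + 1) := by positivity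
    have h2 : (1 : ℝ) / ((m + 1 : ℕ) + 1) ≤ 1 / ((m : ℝ) + 1) :=
      one_div_le_one_div_of_le (by positivity) (by push_cast; linarith)
    rw [abs_of_nonpos (by linarith), abs_of_pos h1, abs_of_pos (h1.trans_le h2)]
    ring

lemma periodNorm_sum_smul_le {p : ℝ} (hp : 1 ≤ p) (s : Finset ℕ) (c : ℕ → ℝ) (F : ℕ → ℝ → ℂ)
    (hF : ∀ i, Continuous (F i)) {K : ℝ≥0∞} (hK : ∀ i, periodNorm p (F i) ≤ K) :
    periodNorm p (fun x => ∑ i ∈ s, c i • F i x) ≤ ENNReal.ofReal (∑ i ∈ s, |c i|) * K := by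
  have h := eLpNorm_sum_le (p := ENNReal.ofReal p) (μ := periodMeasure) (s := s)
    (f := fun i => c i • F i) (fun i _ => ((hF i).const_smul (c i)).aestronglyMeasurable)
    (by simpa using hp)
  have e : (fun x => ∑ i ∈ s, c i • F i x) = ∑ i ∈ s, c i • F i := by ext x; simp
  rw [e]
  refine h.trans ?_
  rw [ENNReal.ofReal_sum_of_nonneg fun i _ => abs_nonneg _, sum_mul]
  refine sum_le_sum fun i _ => ?_
  rw [eLpNorm_const_smul, Real.enorm_eq_ofReal_abs]
  exact mul_le_mul_right (hK i) _

/-- The error of the matrix means of a trigonometric polynomial, expressed through the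
coefficients of its derivative with the row means as multipliers. -/
lemma onCircle_sub_sum_truncate {a : ℕ → ℕ → ℝ} {n m : ℕ} (hzero : ∀ k, n < k → a n k = 0)
    (hsum : ∑ k ∈ range (n + 1), a n k = 1) (P : Polynomial ℂ) (hn : n ≤ m)
    (hm : P.natDegree ≤ m) (x : ℝ) :
    onCircle P x - ∑ k ∈ range (n + 1), a n k • onCircle (truncate (k + 1) P) x =
      ∑ j ∈ range (m + 1), rowMean a n j •
        ((Polynomial.X * P.derivative).coeff (j + 1) * circleMap 0 1 x ^ (j + 1)) := by
  set z := circleMap 0 1 x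
  have hP : onCircle P x = ∑ j ∈ range (m + 2), P.coeff j * z ^ j := by
    rw [← onCircle_truncate, truncate_of_natDegree_lt (by omega)]
  have hk : ∀ k ∈ range (n + 1), onCircle P x - onCircle (truncate (k + 1) P) x =
      ∑ j ∈ range (m + 2), if k < j then P.coeff j * z ^ j else 0 := by
    intro k hk
    rw [mem_range] at hk
    rw [hP, onCircle_truncate, ← sum_filter, sub_eq_iff_eq_add', ← sum_filter_add_sum_filter_not
      (range (m + 2)) (fun j => j < k + 1)]
    congr 1
    · refine sum_congr ?_ fun _ _ => rfl
      ext j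
      simp only [mem_filter, mem_range]
      omega
    · refine sum_congr ?_ fun _ _ => rfl
      ext j
      simp only [mem_filter, mem_range]
      omega
  have h1 : onCircle P x = ∑ k ∈ range (n + 1), a n k • onCircle P x := by
    rw [← sum_smul, hsum, one_smul]
  calc onCircle P x - ∑ k ∈ range (n + 1), a n k • onCircle (truncate (k + 1) P) x
      = ∑ k ∈ range (n + 1), a n k •
          ∑ j ∈ range (m + 2), (if k < j then P.coeff j * z ^ j else 0) := by
        conv_lhs => rw [h1]
        rw [← sum_sub_distrib]
        exact sum_congr rfl fun k hk' => by rw [← smul_sub, hk k hk']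
    _ = ∑ j ∈ range (m + 2), (∑ k ∈ range j, a n k) • (P.coeff j * z ^ j) := by
        simp only [smul_sum]
        rw [sum_comm]
        refine sum_congr rfl fun j hj => ?_
        simp only [smul_ite, smul_zero]
        rw [← sum_filter, sum_smul]
        refine sum_subset (fun k hk' => by simp at hk' ⊢; omega) fun k hk' hk2 => ?_
        rw [hzero k, zero_smul]
        simp only [mem_filter, mem_range] at hk' hk2
        omega
    _ = _ := by
        rw [sum_range_succ', range_zero, sum_empty, zero_smul, add_zero]
        refine sum_congr rfl fun j _ => ?_
        rw [Polynomial.coeff_X_mul, Polynomial.coeff_derivative, rowMean]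
        simp only [Complex.real_smul]
        have : (j : ℂ) + 1 ≠ 0 := Nat.cast_add_one_ne_zero j
        push_cast
        field_simp

/-- The multiplier estimate for trigonometric polynomials. -/
lemma exists_matrixMeans_onCircle_le {p : ℝ} (hp : 1 < p) :
    ∃ C : ℝ≥0, ∀ (P : Polynomial ℂ) (a : ℕ → ℕ → ℝ) (n : ℕ), (∀ k, n < k → a n k = 0) →
      ∑ k ∈ range (n + 1), a n k = 1 →
      periodNorm p (fun x => matrixMeans a (fun t => (onCircle P t).re) n x - (onCircle P x).re) ≤
        ENNReal.ofReal (∑ k ∈ range n, |rowMean a n k - rowMean a n (k + 1)| +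
          1 / ((n : ℝ) + 1)) * (C * periodNorm p (fun x =>
            (onCircle (Polynomial.C Complex.I * (Polynomial.X * P.derivative)) x).re)) := by
  obtain ⟨C₁, hC₁⟩ := exists_periodNorm_onCircle_le_re hp
  obtain ⟨C₂, hC₂⟩ := exists_periodNorm_truncate_le hp
  refine ⟨C₂ * C₁, fun P a n hzero hsum => ?_⟩
  set G : Polynomial ℂ := Polynomial.X * P.derivative with hG
  set K : ℝ≥0∞ := (C₂ * C₁ : ℝ≥0) *
    periodNorm p (fun x => (onCircle (Polynomial.C Complex.I * G) x).re) with hK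
  set m : ℕ := max n P.natDegree with hm
  have hGK : ∀ i, periodNorm p (onCircle (truncate i G)) ≤ K := by
    intro i
    have h1 : periodNorm p (onCircle G) = periodNorm p (onCircle (Polynomial.C Complex.I * G)) :=
      eLpNorm_congr_norm_ae (Filter.Eventually.of_forall fun x => by
        rw [onCircle_mul (Polynomial.C _), onCircle_C]; simp)
    rw [hK, ENNReal.coe_mul, mul_assoc]
    refine (hC₂ G i).trans (mul_le_mul_right ?_ _)
    rw [h1]
    exact hC₁ _ (by simp [hG])
  have hpart : ∀ i x, ∑ j ∈ range i, G.coeff (j + 1) * circleMap 0 1 x ^ (j + 1) =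
      onCircle (truncate (i + 1) G) x := by
    intro i x
    rw [onCircle_truncate, sum_range_succ']
    simp [hG]
  have habel : ∀ x, (onCircle P x - ∑ k ∈ range (n + 1), a n k • onCircle (truncate (k + 1) P) x) =
      rowMean a n m • onCircle (truncate (m + 2) G) x -
        ∑ i ∈ range m, (rowMean a n (i + 1) - rowMean a n i) •
          onCircle (truncate (i + 2) G) x := by
    intro x
    rw [onCircle_sub_sum_truncate hzero hsum P (le_max_left n P.natDegree) (le_max_right _ _) x,
      ← hG, ← hm, sum_range_by_parts]
    simp only [hpart, Nat.add_sub_cancel]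
  have hmeans : ∀ x, matrixMeans a (fun t => (onCircle P t).re) n x - (onCircle P x).re =
      -(onCircle P x - ∑ k ∈ range (n + 1), a n k • onCircle (truncate (k + 1) P) x).re := by
    intro x
    simp [matrixMeans, partialFourierSum_re_onCircle]
  have h1 := periodNorm_sum_smul_le hp.le (range m)
    (fun i => rowMean a n (i + 1) - rowMean a n i) (fun i => onCircle (truncate (i + 2) G))
    (fun i => continuous_onCircle _) (fun i => hGK _)
  have h2 := periodNorm_sum_smul_le hp.le {0} (fun _ => rowMean a n m)
    (fun _ => onCircle (truncate (m + 2) G)) (fun i => continuous_onCircle _) (fun i => hGK _)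
  simp only [sum_singleton] at h2
  have hc1 : Continuous fun x => ∑ i ∈ range m, (rowMean a n (i + 1) - rowMean a n i) •
      onCircle (truncate (i + 2) G) x :=
    continuous_finsetSum _ fun i _ =>
      (continuous_onCircle (truncate (i + 2) G)).const_smul (rowMean a n (i + 1) - rowMean a n i)
  refine (periodNorm_le_add hp.le hc1.aestronglyMeasurable
    ((continuous_onCircle (truncate (m + 2) G)).const_smul (rowMean a n m)).aestronglyMeasurable
    fun x => ?_).trans ((add_le_add h1 h2).trans ?_)
  · rw [hmeans, norm_neg, habel]
    exact (Complex.abs_re_le_norm _).trans ((norm_sub_le _ _).trans_eq (add_comm _ _))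
  · rw [← add_mul, ← ENNReal.ofReal_add (sum_nonneg fun i _ => abs_nonneg _) (abs_nonneg _)]
    exact mul_le_mul_left (ENNReal.ofReal_le_ofReal
      (variation_rowMean_le hzero hsum (le_max_left _ _))) _

lemma ofReal_lpNorm {p : ℝ} (hp : 0 < p) {g : ℝ → ℝ}
    (hg : MemLp g (ENNReal.ofReal p) periodMeasure) :
    ENNReal.ofReal (_root_.lpNorm p g) = periodNorm p g := by
  rw [periodNorm_eq_ofReal hp hg, integral_periodMeasure, _root_.lpNorm, one_div, smul_eq_mul]
  rfl

lemma memLp_comp_add_right {p : ℝ} (hp : 1 < p) {f : ℝ → ℝ} (hf : Function.Periodic f (2 * π))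
    (hm : MemLp f (ENNReal.ofReal p) periodMeasure) (h : ℝ) :
    MemLp (fun x => f (x + h)) (ENNReal.ofReal p) periodMeasure := by
  have hi : Integrable f periodMeasure := hm.integrable (by simpa using hp.le)
  refine ⟨?_, ?_⟩
  · exact ((aestronglyMeasurable_of_periodic hf hi).comp_measurePreserving
      (measurePreserving_add_right volume h)).mono_ac periodMeasure_absolutelyContinuous
  · exact (periodNorm_add_right (by linarith) hf h).trans_lt hm.2

lemma memLp_of_lipClass {α p : ℝ} (hp : 1 < p) {f : ℝ → ℝ} (hf : LipClass α p f) :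
    MemLp f (ENNReal.ofReal p) periodMeasure := by
  obtain ⟨-, h1, h2, -⟩ := hf
  rw [← integrable_periodMeasure_iff] at h1 h2
  refine (integrable_norm_rpow_iff h1.aestronglyMeasurable (by simp; linarith) (by simp)).1 ?_
  rw [ENNReal.toReal_ofReal (by linarith)]
  exact h2

lemma exists_periodNorm_add_sub_le_of_lipClass {p : ℝ} (hp : 1 < p) {f : ℝ → ℝ}
    (hf : LipClass 1 p f) :
    ∃ C : ℝ≥0, ∀ h, periodNorm p (fun x => f (x + h) - f x) ≤ C * ENNReal.ofReal |h| := by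
  have hp0 : 0 < p := by linarith
  have hm := memLp_of_lipClass hp hf
  obtain ⟨hper, -, -, C, hC, hmod⟩ := hf
  refine ⟨C.toNNReal, fun h => ?_⟩
  rcases eq_or_ne h 0 with rfl | hh
  · simp
  have hmh : ∀ h, MemLp (fun x => f (x + h) - f x) (ENNReal.ofReal p) periodMeasure := fun h =>
    (memLp_comp_add_right hp hper hm h).sub hm
  have hbdd : BddAbove {y : ℝ | ∃ h' : ℝ, 0 < |h'| ∧ |h'| ≤ |h| ∧
      y = ((1 / (2 * π)) * ∫ x in (0 : ℝ)..(2 * π), |f (x + h') - f x| ^ p) ^ (1 / p)} := by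
    refine ⟨(periodNorm p f + periodNorm p f).toReal, ?_⟩
    rintro _ ⟨h', -, -, rfl⟩
    change _root_.lpNorm p (fun x => f (x + h') - f x) ≤ _
    rw [← ENNReal.ofReal_le_iff_le_toReal
      (ENNReal.add_ne_top.2 ⟨hm.eLpNorm_ne_top, hm.eLpNorm_ne_top⟩), ofReal_lpNorm hp0 (hmh h')]
    refine (periodNorm_le_add hp.le (memLp_comp_add_right hp hper hm h').1 hm.1
      fun x => norm_sub_le _ _).trans ?_
    rw [periodNorm_add_right hp0 hper]
  have hle : _root_.lpNorm p (fun x => f (x + h) - f x) ≤ C * |h| := by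
    have h1 := hmod |h| (abs_pos.2 hh)
    rw [Real.rpow_one] at h1
    exact (le_csSup hbdd ⟨h, abs_pos.2 hh, le_rfl, rfl⟩).trans h1
  rw [← ofReal_lpNorm hp0 (hmh h)]
  refine (ENNReal.ofReal_le_ofReal hle).trans (le_of_eq ?_)
  rw [ENNReal.ofReal_mul hC.le]
  rfl

lemma periodNorm_sub_le_abs_sin {p : ℝ} {f : ℝ → ℝ} (hf : Function.Periodic f (2 * π)) {C : ℝ≥0}
    (hC : ∀ h, periodNorm p (fun x => f (x + h) - f x) ≤ C * ENNReal.ofReal |h|) (s : ℝ) :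
    periodNorm p (fun x => f (x - s) - f x) ≤
      (C * Real.toNNReal π : ℝ≥0) * ENNReal.ofReal |sin (s / 2)| := by
  set k : ℤ := round (s / (2 * π)) with hk
  set r : ℝ := s - k * (2 * π) with hr
  have hfr : ∀ x, f (x - s) = f (x + -r) := by
    intro x
    rw [← hf.sub_int_mul_eq k (x := x + -r)]
    congr 1
    rw [hr]
    ring
  have hsin : |sin (s / 2)| = |sin (r / 2)| := by
    rw [Real.abs_sin_half, Real.abs_sin_half, hr, Real.cos_periodic.sub_int_mul_eq]
  have hrb : |r / 2| ≤ π / 2 := by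
    have h1 := abs_sub_round (s / (2 * π))
    have h2 : r / 2 = π * (s / (2 * π) - k) := by
      rw [hr]
      field_simp
    rw [h2, abs_mul, abs_of_pos pi_pos]
    calc π * |s / (2 * π) - k| ≤ π * (1 / 2) := by gcongr
      _ = π / 2 := by ring
  have hjordan : |r| ≤ π * |sin (r / 2)| := by
    have h3 := Real.mul_abs_le_abs_sin hrb
    rw [abs_div, abs_two] at h3
    calc |r| = π * (2 / π * (|r| / 2)) := by field_simp
      _ ≤ _ := by gcongr
  simp only [hfr]
  refine (hC (-r)).trans ?_
  rw [abs_neg, ENNReal.coe_mul, mul_assoc, hsin]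
  refine mul_le_mul_right ((ENNReal.ofReal_le_ofReal hjordan).trans (le_of_eq ?_)) _
  rw [ENNReal.ofReal_mul pi_pos.le]
  rfl

lemma enorm_partialFourierSum_le {p : ℝ} (hp : 1 ≤ p) {g : ℝ → ℝ}
    (hg : AEStronglyMeasurable g periodMeasure) (k : ℕ) (x : ℝ) :
    ‖partialFourierSum g k x‖ₑ ≤ (1 + k * 2 : ℝ≥0) * periodNorm p g := by
  rw [partialFourierSum_eq_integral]
  refine (enorm_integral_le_lintegral_enorm _).trans ?_
  have hker : ∀ t, ‖1 + ∑ j ∈ Icc 1 k, 2 * cos (j * (x - t))‖ₑ ≤ ((1 + k * 2 : ℝ≥0) : ℝ≥0∞) := by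
    intro t
    rw [← ofReal_norm, ← ENNReal.ofReal_coe_nnreal]
    refine ENNReal.ofReal_le_ofReal ((norm_add_le _ _).trans ?_)
    push_cast
    rw [norm_one]
    refine add_le_add le_rfl ((norm_sum_le_of_le (Icc 1 k) (n := fun _ => 2) fun j _ => ?_).trans
      (by simp))
    rw [norm_mul, RCLike.norm_ofNat, Real.norm_eq_abs]
    linarith [abs_cos_le_one (j * (x - t))]
  calc ∫⁻ t, ‖g t * (1 + ∑ j ∈ Icc 1 k, 2 * cos (j * (x - t)))‖ₑ ∂periodMeasure
      ≤ ∫⁻ t, (1 + k * 2 : ℝ≥0) * ‖g t‖ₑ ∂periodMeasure := by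
        refine lintegral_mono fun t => ?_
        rw [enorm_mul, mul_comm]
        exact mul_le_mul_left (hker t) _
    _ = (1 + k * 2 : ℝ≥0) * eLpNorm g 1 periodMeasure := by
        rw [lintegral_const_mul' _ _ ENNReal.coe_ne_top, eLpNorm_one_eq_lintegral_enorm]
    _ ≤ _ := mul_le_mul_right
        (eLpNorm_le_eLpNorm_of_exponent_le (by simpa using hp) hg) _

lemma exists_periodNorm_matrixMeans_le {p : ℝ} (hp : 1 ≤ p) (a : ℕ → ℕ → ℝ) (n : ℕ) :
    ∃ D : ℝ≥0, ∀ g : ℝ → ℝ, AEStronglyMeasurable g periodMeasure →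
      periodNorm p (matrixMeans a g n) ≤ D * periodNorm p g := by
  refine ⟨∑ k ∈ range (n + 1), ‖a n k‖₊ * (1 + k * 2), fun g hg => ?_⟩
  have h : ∀ x, ‖matrixMeans a g n x‖ₑ ≤
      (∑ k ∈ range (n + 1), ‖a n k‖₊ * (1 + k * 2) : ℝ≥0) * periodNorm p g := by
    intro x
    rw [matrixMeans, ENNReal.ofNNReal_finsetSum, sum_mul]
    refine (enorm_sum_le _ _).trans (sum_le_sum fun k _ => ?_)
    rw [enorm_mul, ENNReal.coe_mul, mul_assoc]
    exact mul_le_mul_right (enorm_partialFourierSum_le hp hg k x) _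
  have h2 := eLpNorm_le_of_ae_enorm_bound (p := ENNReal.ofReal p) (μ := periodMeasure)
    (Filter.Eventually.of_forall h)
  simpa using h2

lemma matrixMeans_sub (a : ℕ → ℕ → ℝ) {f g : ℝ → ℝ} (hf : Integrable f periodMeasure)
    (hg : Integrable g periodMeasure) (n : ℕ) (x : ℝ) :
    matrixMeans a (fun t => f t - g t) n x = matrixMeans a f n x - matrixMeans a g n x := by
  simp only [matrixMeans]
  rw [← sum_sub_distrib]
  refine sum_congr rfl fun k _ => ?_
  rw [← mul_sub]
  congr 1
  have hi : ∀ {g : ℝ → ℝ}, Integrable g periodMeasure → IntervalIntegrable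
      (fun t => g t * dirichletKernel k (x - t)) volume 0 (2 * π) := fun h =>
    (integrable_periodMeasure_iff.1 h).mul_continuousOn
      (by unfold dirichletKernel; fun_prop)
  rw [partialFourierSum, partialFourierSum, partialFourierSum, ← mul_sub,
    ← intervalIntegral.integral_sub (hi hf) (hi hg)]
  simp only [sub_mul]

lemma continuous_partialFourierSum {f : ℝ → ℝ} (hf : Function.Periodic f (2 * π))
    (hi : Integrable f periodMeasure) (k : ℕ) : Continuous (partialFourierSum f k) := by
  set κ : Polynomial ℂ := 1 + ∑ j ∈ Icc 1 k, Polynomial.monomial j 2 with hκ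
  have hk : ∀ x, 1 + ∑ j ∈ Icc 1 k, 2 * cos (j * x) = (onCircle κ x).re := by
    intro x
    have hj : ∀ j : ℕ, circleMap 0 1 x ^ j = circleMap 0 1 (j * x) := by
      intro j
      simp only [circleMap, zero_add, Complex.ofReal_one, one_mul, ← Complex.exp_nat_mul]
      congr 1
      push_cast
      ring
    simp [hκ, onCircle, Polynomial.eval_finsetSum, hj, circleMap_re]
  obtain ⟨Q, hQ⟩ := isTrigPoly_convolution hf hi ⟨κ, fun x => rfl⟩
  have : partialFourierSum f k = fun x => (onCircle Q x).re := by
    ext x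
    have hκper : Function.Periodic (fun s => (onCircle κ s).re) (2 * π) := fun s => by
      simp only [onCircle_periodic κ s]
    refine Eq.trans ?_ ((integral_mul_comp_sub hf hκper x).symm.trans (hQ x))
    rw [partialFourierSum_eq_integral]
    simp only [hk]
    simp only [mul_comm]
  rw [this]
  exact continuous_re_onCircle Q

lemma continuous_matrixMeans {f : ℝ → ℝ} (hf : Function.Periodic f (2 * π))
    (hi : Integrable f periodMeasure) (a : ℕ → ℕ → ℝ) (n : ℕ) : Continuous (matrixMeans a f n) :=
  continuous_finsetSum _ fun k _ => continuous_const.mul (continuous_partialFourierSum hf hi k)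

/-- The approximation error of the matrix means in `Lip(1, p)` is controlled by the variation of
the row means. -/
lemma exists_periodNorm_matrixMeans_sub_le {p : ℝ} (hp : 1 < p) {f : ℝ → ℝ}
    (hf : LipClass 1 p f) :
    ∃ C : ℝ≥0, ∀ (a : ℕ → ℕ → ℝ) (n : ℕ), (∀ k, n < k → a n k = 0) →
      ∑ k ∈ range (n + 1), a n k = 1 →
      periodNorm p (fun x => matrixMeans a f n x - f x) ≤
        ENNReal.ofReal (∑ k ∈ range n, |rowMean a n k - rowMean a n (k + 1)| +
          1 / ((n : ℝ) + 1)) * C := by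
  have hm := memLp_of_lipClass hp hf
  have hi : Integrable f periodMeasure := hm.integrable (by simpa using hp.le)
  obtain ⟨L, hL⟩ := exists_periodNorm_add_sub_le_of_lipClass hp hf
  have hper := hf.1
  obtain ⟨C, hC⟩ := exists_matrixMeans_onCircle_le hp
  refine ⟨C * L, fun a n hzero hsum => ENNReal.le_of_forall_pos_le_add fun η hη _ => ?_⟩
  obtain ⟨D, hD⟩ := exists_periodNorm_matrixMeans_le hp.le a n
  have hε : (0 : ℝ≥0∞) < (η / (1 + D) : ℝ≥0) := by
    rw [ENNReal.coe_pos]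
    positivity
  obtain ⟨P, hP, hPL, -⟩ := exists_onCircle_approx hp.le hper hm
    (periodNorm_sub_le_abs_sin hper hL) hε
  set t : ℝ → ℝ := fun x => (onCircle P x).re with ht
  have hct : Continuous t := continuous_re_onCircle P
  have htper : Function.Periodic t (2 * π) := fun x => by simp only [ht, onCircle_periodic P x]
  have hcM := continuous_matrixMeans htper hct.integrable_periodMeasure a n
  have hcF := continuous_matrixMeans hper hi a n
  have h1 := (hC P a n hzero hsum).trans (mul_le_mul_right (mul_le_mul_right
    (periodNorm_deriv_le fun h => (hPL h).trans (hL h)) _) _)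
  have hmd : AEStronglyMeasurable (fun x => t x - f x) periodMeasure :=
    hct.aestronglyMeasurable.sub hm.1
  have h2 := (hD _ hmd).trans (mul_le_mul_right hP _)
  have h3 : periodNorm p (fun x => matrixMeans a f n x - f x) ≤
      periodNorm p (fun x => matrixMeans a t n x - t x) +
        (periodNorm p (fun x => t x - f x) +
          periodNorm p (matrixMeans a (fun x => t x - f x) n)) := by
    have hmD : AEStronglyMeasurable (matrixMeans a (fun x => t x - f x) n) periodMeasure := by
      have : matrixMeans a (fun x => t x - f x) n =
          fun x => matrixMeans a t n x - matrixMeans a f n x :=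
        funext fun x => matrixMeans_sub a hct.integrable_periodMeasure hi n x
      rw [this]
      exact (hcM.sub hcF).aestronglyMeasurable
    refine (periodNorm_le_add hp.le (hcM.sub hct).aestronglyMeasurable (hmd.sub hmD)
      fun x => ?_).trans (add_le_add le_rfl (periodNorm_le_add hp.le hmd hmD
        fun x => norm_sub_le _ _))
    refine le_trans (le_of_eq ?_) (norm_add_le _ _)
    congr 1
    simp only [Pi.sub_apply, matrixMeans_sub a hct.integrable_periodMeasure hi n x]
    ring
  refine h3.trans ((add_le_add h1 (add_le_add hP h2)).trans (le_of_eq ?_))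
  rw [ENNReal.coe_mul]
  congr 1
  have h4 : η / (1 + D) + D * (η / (1 + D)) = η := by field_simp
  exact_mod_cast h4

end TrigApprox

/-- Theorem 5 (iii): if `f ∈ Lip(1,p)`, `p > 1`, the matrix is
nonnegative, lower triangular with row sums `1`, and
`∑_{k=0}^{n-1} |A_{n,k} - A_{n,k+1}| = O(n^{-1})` where
`A_{n,m} = (1/(m+1)) ∑_{k=0}^m a_{n,k}`, then `‖T_n(f) - f‖_{L^p} = O(n^{-1})`. -/
theorem trig_approx_rowMean_variation (p : ℝ) (hp : 1 < p)
    (f : ℝ → ℝ) (hf : LipClass 1 p f)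
    (a : ℕ → ℕ → ℝ)
    (hpos : ∀ n k, k ≤ n → 0 ≤ a n k)
    (hzero : ∀ n k, n < k → a n k = 0)
    (hsum : ∀ n, ∑ k ∈ Finset.range (n + 1), a n k = 1)
    (hvar : ∃ C : ℝ, ∀ n : ℕ, 1 ≤ n →
      ∑ k ∈ Finset.range n, |rowMean a n k - rowMean a n (k + 1)| ≤ C / (n : ℝ)) :
    ∃ C : ℝ, ∀ n : ℕ, 1 ≤ n →
      lpNorm p (fun x => matrixMeans a f n x - f x) ≤ C / (n : ℝ) := by
  obtain ⟨C', hC'⟩ := hvar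
  obtain ⟨C, hC⟩ := TrigApprox.exists_periodNorm_matrixMeans_sub_le hp hf
  have hm := TrigApprox.memLp_of_lipClass hp hf
  have hi : Integrable f TrigApprox.periodMeasure := hm.integrable (by simpa using hp.le)
  refine ⟨(C' + 1) * C, fun n hn => ?_⟩
  have hn0 : (0 : ℝ) < n := by exact_mod_cast hn
  have h1 := hC a n (hzero n) (hsum n)
  have hmem : MemLp (fun x => matrixMeans a f n x - f x) (ENNReal.ofReal p)
      TrigApprox.periodMeasure :=
    ((TrigApprox.continuous_matrixMeans hf.1 hi a n).memLp_periodMeasure _).sub hm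
  rw [← TrigApprox.ofReal_lpNorm (by linarith) hmem, ← ENNReal.ofReal_coe_nnreal,
    ← ENNReal.ofReal_mul (by positivity), ENNReal.ofReal_le_ofReal_iff (by positivity)] at h1
  refine h1.trans ?_
  rw [mul_div_right_comm]
  refine mul_le_mul_of_nonneg_right ?_ C.coe_nonneg
  rw [add_div]
  exact add_le_add (hC' n hn) (one_div_le_one_div_of_le hn0 (by linarith))
end

section
/- Let f ∈ Lip(α,1) with 0 < α < 1, and let (a_{n,k}) be a lower triangular matrix with a_{n,k} ≥ 0 for k ≤ n, a_{n,k} = 0 for k > n, and ∑_{k=0}^n a_{n,k} = 1 for all n. If ∑_{k=0}^{n−1} |a_{n,k} − a_{n,k+1}| = O(n^{−1}) and (n+1)a_{n,n} = O(1), then ‖T_n(f) − f‖_{L^1} = O(n^{−α}). -/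
open MeasureTheory Finset Real

/-! ### Dirichlet kernels and their averages -/

lemma continuous_dirichletKernel (k : ℕ) : Continuous (dirichletKernel k) := by
  unfold dirichletKernel; fun_prop

lemma dirichletKernel_neg (k : ℕ) (u : ℝ) : dirichletKernel k (-u) = dirichletKernel k u := by
  simp [dirichletKernel]

lemma dirichletKernel_periodic (k : ℕ) : Function.Periodic (dirichletKernel k) (2 * π) := by
  intro u
  simp only [dirichletKernel, mul_add, Real.cos_add_nat_mul_two_pi]

lemma dirichletKernel_succ (k : ℕ) (u : ℝ) :
    dirichletKernel (k + 1) u = dirichletKernel k u + Real.cos ((k + 1 : ℝ) * u) := by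
  simp only [dirichletKernel]
  rw [Finset.sum_Icc_succ_top (by omega)]
  push_cast
  ring

lemma abs_dirichletKernel_le (k : ℕ) (u : ℝ) : |dirichletKernel k u| ≤ k + 1 := by
  induction k with
  | zero => norm_num [dirichletKernel]
  | succ k ih =>
    rw [dirichletKernel_succ]
    push_cast
    exact (abs_add_le _ _).trans (add_le_add ih (Real.abs_cos_le_one _))

lemma integral_dirichletKernel (k : ℕ) : ∫ u in (-π)..π, dirichletKernel k u = π := by
  induction k with
  | zero =>
    simp [dirichletKernel]
    ring
  | succ k ih =>
    have hcos : ∫ u in (-π)..π, Real.cos ((k + 1 : ℝ) * u) = 0 := by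
      have hk : (k + 1 : ℝ) ≠ 0 := by positivity
      have hs : Real.sin ((k + 1 : ℝ) * π) = 0 := by
        exact_mod_cast Real.sin_nat_mul_pi (k + 1)
      rw [intervalIntegral.integral_comp_mul_left (fun x => Real.cos x) hk, integral_cos]
      simp [hs]
    simp only [dirichletKernel_succ]
    rw [intervalIntegral.integral_add ((continuous_dirichletKernel k).intervalIntegrable _ _)
      (Continuous.intervalIntegrable (by fun_prop) _ _), ih, hcos, add_zero]

lemma one_sub_cos_mul_dirichletKernel (k : ℕ) (u : ℝ) :
    (1 - Real.cos u) * dirichletKernel k u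
      = (Real.cos (k * u) - Real.cos ((k + 1 : ℝ) * u)) / 2 := by
  induction k with
  | zero => simp [dirichletKernel]; ring
  | succ k ih =>
    rw [dirichletKernel_succ, mul_add, ih]
    have h₁ : (((k + 1 : ℕ) : ℝ) + 1) * u = (k + 1 : ℝ) * u + u := by push_cast; ring
    have h₂ : (k : ℝ) * u = (k + 1 : ℝ) * u - u := by ring
    rw [h₁, h₂, Real.cos_add, Real.cos_sub]
    push_cast
    ring

lemma one_sub_cos_mul_sum_dirichletKernel (m : ℕ) (u : ℝ) :
    (1 - Real.cos u) * ∑ k ∈ Finset.range m, dirichletKernel k u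
      = (1 - Real.cos (m * u)) / 2 := by
  induction m with
  | zero => simp
  | succ m ih =>
    rw [Finset.sum_range_succ, mul_add, ih, one_sub_cos_mul_dirichletKernel]
    push_cast
    ring

/-- The Fejér bound for sums of Dirichlet kernels. -/
lemma abs_sum_dirichletKernel_le (m : ℕ) {u : ℝ} (hu0 : u ≠ 0) (hu : |u| ≤ π) :
    |∑ k ∈ Finset.range m, dirichletKernel k u| ≤ π ^ 2 / 2 / u ^ 2 := by
  have hu2 : 0 < u ^ 2 := by positivity
  have hpi := Real.pi_pos
  have hc : 2 / π ^ 2 * u ^ 2 ≤ 1 - Real.cos u := by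
    linarith [Real.cos_le_one_sub_mul_cos_sq hu]
  have h := one_sub_cos_mul_sum_dirichletKernel m u
  have hb : |(1 - Real.cos (m * u)) / 2| ≤ 1 := by
    rw [abs_le]
    constructor <;> linarith [Real.cos_le_one (m * u), Real.neg_one_le_cos (m * u)]
  have hd : 0 < 2 / π ^ 2 * u ^ 2 := by positivity
  rw [← h, abs_mul, abs_of_pos (hd.trans_le hc)] at hb
  have := (mul_le_mul_of_nonneg_right hc (abs_nonneg _)).trans hb
  rw [show π ^ 2 / 2 / u ^ 2 = 1 / (2 / π ^ 2 * u ^ 2) by field_simp, le_div_iff₀ hd]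
  linarith

/-- The kernel `∑_{k ≤ n} w_k D_k` of a weighted mean of Fourier partial sums. -/
noncomputable def dirichletMean (w : ℕ → ℝ) (n : ℕ) (u : ℝ) : ℝ :=
  ∑ k ∈ Finset.range (n + 1), w k * dirichletKernel k u

lemma continuous_dirichletMean (w : ℕ → ℝ) (n : ℕ) : Continuous (dirichletMean w n) :=
  continuous_finsetSum _ fun k _ => continuous_const.mul (continuous_dirichletKernel k)

lemma dirichletMean_neg (w : ℕ → ℝ) (n : ℕ) (u : ℝ) :
    dirichletMean w n (-u) = dirichletMean w n u := by
  simp [dirichletMean, dirichletKernel_neg]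

lemma dirichletMean_periodic (w : ℕ → ℝ) (n : ℕ) :
    Function.Periodic (dirichletMean w n) (2 * π) := by
  intro u
  simp only [dirichletMean, dirichletKernel_periodic _ u]

lemma integral_dirichletMean {w : ℕ → ℝ} {n : ℕ}
    (hw : ∑ k ∈ Finset.range (n + 1), w k = 1) :
    ∫ u in (-π)..π, dirichletMean w n u = π := by
  simp only [dirichletMean]
  rw [intervalIntegral.integral_finsetSum fun k _ =>
    ((continuous_dirichletKernel k).intervalIntegrable _ _).const_mul (w k)]
  simp only [intervalIntegral.integral_const_mul, integral_dirichletKernel]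
  rw [← Finset.sum_mul, hw, one_mul]

lemma abs_dirichletMean_le {w : ℕ → ℝ} {n : ℕ} (hpos : ∀ k, k ≤ n → 0 ≤ w k)
    (hw : ∑ k ∈ Finset.range (n + 1), w k = 1) (u : ℝ) :
    |dirichletMean w n u| ≤ n + 1 := by
  calc |dirichletMean w n u|
      ≤ ∑ k ∈ Finset.range (n + 1), |w k * dirichletKernel k u| :=
        Finset.abs_sum_le_sum_abs _ _
    _ ≤ ∑ k ∈ Finset.range (n + 1), w k * (n + 1 : ℝ) := by
        refine Finset.sum_le_sum fun k hk => ?_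
        have hk' : k ≤ n := Nat.lt_succ_iff.mp (Finset.mem_range.mp hk)
        rw [abs_mul, abs_of_nonneg (hpos k hk')]
        refine mul_le_mul_of_nonneg_left ((abs_dirichletKernel_le k u).trans ?_) (hpos k hk')
        exact_mod_cast Nat.succ_le_succ hk'
    _ = n + 1 := by rw [← Finset.sum_mul, hw, one_mul]

/-- Summation by parts bounds a mean of Dirichlet kernels by the variation of its weights. -/
lemma abs_dirichletMean_le_variation (w : ℕ → ℝ) (n : ℕ) {u : ℝ} (hu0 : u ≠ 0) (hu : |u| ≤ π) :
    |dirichletMean w n u|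
      ≤ (∑ k ∈ Finset.range n, |w k - w (k + 1)| + |w n|) * (π ^ 2 / 2 / u ^ 2) := by
  have hparts := Finset.sum_range_by_parts w (fun k => dirichletKernel k u) (n + 1)
  simp only [smul_eq_mul, Nat.add_sub_cancel] at hparts
  rw [dirichletMean, hparts, add_mul, add_comm (_ * _), Finset.sum_mul]
  refine (abs_sub _ _).trans (add_le_add ?_ ?_)
  · rw [abs_mul]
    exact mul_le_mul_of_nonneg_left (abs_sum_dirichletKernel_le _ hu0 hu) (abs_nonneg _)
  · refine (Finset.abs_sum_le_sum_abs _ _).trans (Finset.sum_le_sum fun k _ => ?_)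
    rw [abs_mul, abs_sub_comm]
    exact mul_le_mul_of_nonneg_left (abs_sum_dirichletKernel_le _ hu0 hu) (abs_nonneg _)

/-! ### Moments of concentrated even kernels -/

/-- The `α`-th absolute moment of a kernel bounded by `N` and by `B / (N u²)` is `O(N^{-α})`. -/
lemma integral_rpow_mul_abs_le {α : ℝ} (hα0 : 0 < α) (hα1 : α < 1) {K : ℝ → ℝ}
    (hK : Continuous K) {A B N : ℝ} (hN : 1 ≤ N) (hB : 0 ≤ B)
    (h₁ : ∀ u, |K u| ≤ A * N) (h₂ : ∀ u, 0 < u → u ≤ π → |K u| ≤ B / N / u ^ 2) :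
    ∫ u in (0 : ℝ)..π, u ^ α * |K u| ≤ (A + B / (1 - α)) * N ^ (-α) := by
  have hN0 : 0 < N := by linarith
  have hpi : N⁻¹ ≤ π := (inv_le_one_of_one_le₀ hN).trans (by linarith [Real.pi_gt_three])
  have hNi : 0 < N⁻¹ := by positivity
  have hcont : Continuous fun u : ℝ => u ^ α * |K u| :=
    (Real.continuous_rpow_const hα0.le).mul hK.abs
  have hpow : (N⁻¹) ^ α = N ^ (-α) := by
    rw [Real.inv_rpow hN0.le, Real.rpow_neg hN0.le]
  have hnear : ∫ u in (0 : ℝ)..N⁻¹, u ^ α * |K u| ≤ A * N ^ (-α) := by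
    have h : ‖∫ u in (0 : ℝ)..N⁻¹, u ^ α * |K u|‖ ≤ N ^ (-α) * (A * N) * |N⁻¹ - 0| := by
      refine intervalIntegral.norm_integral_le_of_norm_le_const fun u hu => ?_
      rw [Set.uIoc_of_le hNi.le] at hu
      have hu0 : 0 ≤ u ^ α := Real.rpow_nonneg hu.1.le _
      rw [Real.norm_eq_abs, abs_mul, abs_abs, abs_of_nonneg hu0, ← hpow]
      exact mul_le_mul (Real.rpow_le_rpow hu.1.le hu.2 hα0.le) (h₁ u) (abs_nonneg _)
        (Real.rpow_nonneg hNi.le _)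
    refine (le_abs_self _).trans (h.trans_eq ?_)
    rw [sub_zero, abs_of_pos hNi]
    field_simp
  have hfar : ∫ u in N⁻¹..π, u ^ α * |K u| ≤ B / (1 - α) * N ^ (-α) := by
    have hzero : (0 : ℝ) ∉ Set.uIcc N⁻¹ π := by
      rw [Set.uIcc_of_le hpi]
      exact fun h => absurd h.1 (not_le.mpr hNi)
    have hle : ∫ u in N⁻¹..π, u ^ α * |K u| ≤ ∫ u in N⁻¹..π, B / N * u ^ (α - 2) := by
      refine intervalIntegral.integral_mono_on hpi (hcont.intervalIntegrable _ _)
        ((intervalIntegral.intervalIntegrable_rpow (Or.inr hzero)).const_mul _) fun u hu => ?_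
      have hu0 : 0 < u := hNi.trans_le hu.1
      refine (mul_le_mul_of_nonneg_left (h₂ u hu0 hu.2) (Real.rpow_nonneg hu0.le _)).trans_eq ?_
      rw [Real.rpow_sub hu0, Real.rpow_two]
      ring
    refine hle.trans ?_
    rw [intervalIntegral.integral_const_mul, integral_rpow (Or.inr ⟨by linarith, hzero⟩)]
    have hNpow : (N⁻¹) ^ (α - 2 + 1) = N * N ^ (-α) := by
      rw [Real.inv_rpow hN0.le, ← Real.rpow_neg hN0.le, ← Real.rpow_one_add' hN0.le (by linarith)]
      congr 1
      ring
    have h1α : 0 < 1 - α := by linarith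
    have hsub : (π ^ (α - 2 + 1) - (N⁻¹) ^ (α - 2 + 1)) / (α - 2 + 1)
        ≤ N * N ^ (-α) / (1 - α) := by
      rw [hNpow, show α - 2 + 1 = -(1 - α) by ring, div_neg, ← neg_div]
      gcongr
      linarith [Real.rpow_nonneg Real.pi_pos.le (-(1 - α))]
    refine (mul_le_mul_of_nonneg_left hsub (by positivity)).trans_eq ?_
    field_simp
  rw [← intervalIntegral.integral_add_adjacent_intervals (hcont.intervalIntegrable 0 N⁻¹)
    (hcont.intervalIntegrable N⁻¹ π), add_mul]
  exact add_le_add hnear hfar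

lemma integral_even_eq_two_mul {g : ℝ → ℝ} (hg : Continuous g) (heven : ∀ u, g (-u) = g u)
    (b : ℝ) : ∫ u in (-b)..b, g u = 2 * ∫ u in (0 : ℝ)..b, g u := by
  rw [← intervalIntegral.integral_add_adjacent_intervals (hg.intervalIntegrable (-b) 0)
    (hg.intervalIntegrable 0 b)]
  have h := intervalIntegral.integral_comp_neg (a := 0) (b := b) g
  simp only [heven, neg_zero] at h
  rw [← h]
  ring

/-! ### Periodic integrable functions -/

lemma periodic_intervalIntegrable {f : ℝ → ℝ} (hper : Function.Periodic f (2 * π))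
    (hint : IntervalIntegrable f volume 0 (2 * π)) (s t : ℝ) :
    IntervalIntegrable f volume s t :=
  hper.intervalIntegrable₀ (by positivity) hint s t

lemma intervalIntegrable_comp_const_add {f : ℝ → ℝ} (hper : Function.Periodic f (2 * π))
    (hint : IntervalIntegrable f volume 0 (2 * π)) (x s t : ℝ) :
    IntervalIntegrable (fun u => f (x + u)) volume s t := by
  have h := (periodic_intervalIntegrable hper hint (x + s) (x + t)).comp_add_left x
  simpa using h

lemma intervalIntegrable_comp_add_const {f : ℝ → ℝ} (hper : Function.Periodic f (2 * π))
    (hint : IntervalIntegrable f volume 0 (2 * π)) (h s t : ℝ) :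
    IntervalIntegrable (fun x => f (x + h)) volume s t := by
  simpa only [add_comm] using intervalIntegrable_comp_const_add hper hint h s t

lemma aestronglyMeasurable_of_periodic {f : ℝ → ℝ} (hper : Function.Periodic f (2 * π))
    (hint : IntervalIntegrable f volume 0 (2 * π)) : AEStronglyMeasurable f volume := by
  refine LocallyIntegrable.aestronglyMeasurable
    (locallyIntegrable_iff.mpr fun k hk => ?_)
  obtain ⟨r, hr⟩ := hk.isBounded.subset_closedBall 0
  rw [Real.closedBall_eq_Icc] at hr
  refine IntegrableOn.mono_set ?_ (hr.trans Set.Icc_subset_uIcc)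
  exact (intervalIntegrable_iff' (by finiteness)).mp (periodic_intervalIntegrable hper hint _ _)

/-- Convolution against an even periodic kernel, written with differences of `f`. -/
lemma convolution_sub_eq {f K : ℝ → ℝ} (hper : Function.Periodic f (2 * π))
    (hint : IntervalIntegrable f volume 0 (2 * π)) (hK : Continuous K)
    (heven : ∀ u, K (-u) = K u) (hKper : Function.Periodic K (2 * π))
    (hmass : ∫ u in (-π)..π, K u = π) (x : ℝ) :
    (1 / π) * (∫ t in (0 : ℝ)..(2 * π), f t * K (x - t)) - f x
      = (1 / π) * ∫ u in (-π)..π, (f (x + u) - f x) * K u := by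
  have hshift : ∫ t in (0 : ℝ)..(2 * π), f t * K (x - t)
      = ∫ u in (-π)..π, f (x + u) * K u := by
    have hperiodic : Function.Periodic (fun t => f t * K (x - t)) (2 * π) := by
      intro t
      simp only [hper t, ← sub_sub, hKper.sub_eq]
    have h := hperiodic.intervalIntegral_add_eq 0 (x - π)
    rw [zero_add, show x - π + 2 * π = x + π by ring] at h
    have h' := intervalIntegral.integral_comp_add_left (a := -π) (b := π)
      (fun t => f t * K (x - t)) x
    rw [← sub_eq_add_neg] at h'
    rw [h, ← h']
    refine intervalIntegral.integral_congr fun u _ => ?_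
    simp only [sub_add_cancel_left, heven]
  simp only [sub_mul]
  rw [intervalIntegral.integral_sub
    ((intervalIntegrable_comp_const_add hper hint x _ _).mul_continuousOn hK.continuousOn)
    ((hK.intervalIntegrable _ _).const_mul _), intervalIntegral.integral_const_mul, hmass, hshift]
  have := Real.pi_ne_zero
  field_simp

/-- Minkowski's inequality for convolutions: the `L¹` error is controlled by the translates. -/
lemma integral_abs_integral_sub_mul_le {f K ψ : ℝ → ℝ} (hper : Function.Periodic f (2 * π))
    (hint : IntervalIntegrable f volume 0 (2 * π)) (hK : Continuous K) (hψ : Continuous ψ)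
    (hbound : ∀ u, ∫ x in (0 : ℝ)..(2 * π), |f (x + u) - f x| ≤ ψ u) :
    ∫ x in (0 : ℝ)..(2 * π), |∫ u in (-π)..π, (f (x + u) - f x) * K u|
      ≤ ∫ u in (-π)..π, ψ u * |K u| := by
  have hpi := Real.pi_pos
  have h2π : (0 : ℝ) ≤ 2 * π := by positivity
  have hππ : -π ≤ π := by linarith
  simp only [intervalIntegral.integral_of_le h2π, intervalIntegral.integral_of_le hππ] at hbound ⊢
  set μ := volume.restrict (Set.Ioc 0 (2 * π)) with hμ
  set ν := volume.restrict (Set.Ioc (-π) π) with hν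
  have hmeas := aestronglyMeasurable_of_periodic hper hint
  have hadd : AEStronglyMeasurable (fun z : ℝ × ℝ => f (z.1 + z.2)) (μ.prod ν) := by
    have h : AEStronglyMeasurable (fun z : ℝ × ℝ => f (z.1 + z.2))
        ((volume : Measure ℝ).prod volume) :=
      hmeas.comp_quasiMeasurePreserving (Measure.quasiMeasurePreserving_snd.comp
        (measurePreserving_prod_add (volume : Measure ℝ) volume).quasiMeasurePreserving)
    rw [hμ, hν, Measure.prod_restrict]
    exact h.restrict
  have hF : AEStronglyMeasurable (fun z : ℝ × ℝ => (f (z.1 + z.2) - f z.1) * K z.2)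
      (μ.prod ν) :=
    (hadd.sub hmeas.restrict.comp_fst).mul hK.aestronglyMeasurable.comp_snd
  have hdiff : ∀ u, Integrable (fun x => f (x + u) - f x) μ := fun u =>
    ((intervalIntegrable_iff_integrableOn_Ioc_of_le h2π).mp
      (intervalIntegrable_comp_add_const hper hint u _ _)).sub
      ((intervalIntegrable_iff_integrableOn_Ioc_of_le h2π).mp hint)
  have hle : ∀ u, ∫ x, ‖(f (x + u) - f x) * K u‖ ∂μ ≤ ψ u * |K u| := by
    intro u
    simp only [norm_mul, Real.norm_eq_abs]
    rw [integral_mul_const]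
    exact mul_le_mul_of_nonneg_right (hbound u) (abs_nonneg _)
  have hψK : Integrable (fun u => ψ u * |K u|) ν :=
    (intervalIntegrable_iff_integrableOn_Ioc_of_le hππ).mp
      ((hψ.mul hK.abs).intervalIntegrable _ _)
  have hFint : Integrable (fun z : ℝ × ℝ => (f (z.1 + z.2) - f z.1) * K z.2) (μ.prod ν) := by
    rw [integrable_prod_iff' hF]
    refine ⟨Filter.Eventually.of_forall fun u => (hdiff u).mul_const (K u), ?_⟩
    refine hψK.mono' hF.norm.prod_swap.integral_prod_right' (Filter.Eventually.of_forall fun u => ?_)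
    rw [Real.norm_of_nonneg (integral_nonneg fun _ => norm_nonneg _)]
    exact hle u
  calc ∫ x, |∫ u, (f (x + u) - f x) * K u ∂ν| ∂μ
      ≤ ∫ x, ∫ u, ‖(f (x + u) - f x) * K u‖ ∂ν ∂μ :=
        integral_mono_of_nonneg (Filter.Eventually.of_forall fun _ => abs_nonneg _)
          hFint.integral_norm_prod_left
          (Filter.Eventually.of_forall fun x =>
            norm_integral_le_integral_norm fun u => (f (x + u) - f x) * K u)
    _ = ∫ u, ∫ x, ‖(f (x + u) - f x) * K u‖ ∂μ ∂ν := integral_integral_swap hFint.norm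
    _ ≤ ∫ u, ψ u * |K u| ∂ν :=
        integral_mono_of_nonneg
          (Filter.Eventually.of_forall fun _ => integral_nonneg fun _ => norm_nonneg _) hψK
          (Filter.Eventually.of_forall hle)

/-- The `L¹` modulus of continuity bounds the `L¹` norms of the individual differences. -/
lemma integral_abs_sub_le_intModulus {f : ℝ → ℝ} (hper : Function.Periodic f (2 * π))
    (hint : IntervalIntegrable f volume 0 (2 * π)) {h : ℝ} (hh : h ≠ 0) :
    ∫ x in (0 : ℝ)..(2 * π), |f (x + h) - f x| ≤ 2 * π * intModulus 1 f |h| := by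
  have h2π : (0 : ℝ) < 2 * π := by positivity
  have hbdd : ∀ h : ℝ, ∫ x in (0 : ℝ)..(2 * π), |f (x + h) - f x|
      ≤ 2 * ∫ x in (0 : ℝ)..(2 * π), |f x| := by
    intro h
    have hi := intervalIntegrable_comp_add_const hper hint h 0 (2 * π)
    have habs : Function.Periodic (fun x => |f x|) (2 * π) := fun x => by simp only [hper x]
    have heq : ∫ x in (0 : ℝ)..(2 * π), |f (x + h)| = ∫ x in (0 : ℝ)..(2 * π), |f x| := by
      rw [intervalIntegral.integral_comp_add_right (fun x => |f x|), zero_add, add_comm (2 * π) h]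
      simpa using habs.intervalIntegral_add_eq h 0
    calc ∫ x in (0 : ℝ)..(2 * π), |f (x + h) - f x|
        ≤ ∫ x in (0 : ℝ)..(2 * π), (|f (x + h)| + |f x|) :=
          intervalIntegral.integral_mono_on h2π.le (hi.sub hint).abs (hi.abs.add hint.abs)
            fun x _ => abs_sub _ _
      _ = 2 * ∫ x in (0 : ℝ)..(2 * π), |f x| := by
          rw [intervalIntegral.integral_add hi.abs hint.abs, heq]
          ring
  have hle : (1 / (2 * π)) * ∫ x in (0 : ℝ)..(2 * π), |f (x + h) - f x|
      ≤ intModulus 1 f |h| := by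
    refine le_csSup ⟨(1 / (2 * π)) * (2 * ∫ x in (0 : ℝ)..(2 * π), |f x|), ?_⟩
      ⟨h, abs_pos.mpr hh, le_rfl, by simp⟩
    rintro y ⟨h, -, -, rfl⟩
    simp only [Real.rpow_one, div_one]
    exact mul_le_mul_of_nonneg_left (hbdd h) (by positivity)
  rwa [one_div, inv_mul_le_iff₀ h2π] at hle

lemma matrixMeans_eq_integral {f : ℝ → ℝ} (hint : IntervalIntegrable f volume 0 (2 * π))
    (a : ℕ → ℕ → ℝ) (n : ℕ) (x : ℝ) :
    matrixMeans a f n x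
      = (1 / π) * ∫ t in (0 : ℝ)..(2 * π), f t * dirichletMean (a n) n (x - t) := by
  have hi : ∀ k, IntervalIntegrable (fun t => a n k * (f t * dirichletKernel k (x - t)))
      volume 0 (2 * π) := fun k =>
    (hint.mul_continuousOn ((continuous_dirichletKernel k).comp
      (continuous_const.sub continuous_id)).continuousOn).const_mul _
  simp only [matrixMeans, partialFourierSum, dirichletMean, Finset.mul_sum, mul_left_comm (f _)]
  rw [intervalIntegral.integral_finsetSum fun k _ => hi k, Finset.mul_sum]
  refine Finset.sum_congr rfl fun k _ => ?_
  rw [intervalIntegral.integral_const_mul]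
  ring

/-- Theorem 5 (iv): if `f ∈ Lip(α,1)`, `0 < α < 1`, the matrix is
nonnegative, lower triangular with row sums `1`,
`∑_{k=0}^{n-1} |a_{n,k} - a_{n,k+1}| = O(n^{-1})` and `(n+1)a_{n,n} = O(1)`, then
`‖T_n(f) - f‖_{L^1} = O(n^{-α})`. -/
theorem trig_approx_row_variation (α : ℝ) (hα0 : 0 < α) (hα1 : α < 1)
    (f : ℝ → ℝ) (hf : LipClass α 1 f)
    (a : ℕ → ℕ → ℝ)
    (hpos : ∀ n k, k ≤ n → 0 ≤ a n k)
    (hzero : ∀ n k, n < k → a n k = 0)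
    (hsum : ∀ n, ∑ k ∈ Finset.range (n + 1), a n k = 1)
    (hvar : ∃ C : ℝ, ∀ n : ℕ, 1 ≤ n →
      ∑ k ∈ Finset.range n, |a n k - a n (k + 1)| ≤ C / (n : ℝ))
    (hO : ∃ C : ℝ, ∀ n : ℕ, ((n : ℝ) + 1) * a n n ≤ C) :
    ∃ C : ℝ, ∀ n : ℕ, 1 ≤ n →
      lpNorm 1 (fun x => matrixMeans a f n x - f x) ≤ C * (n : ℝ) ^ (-α) := by
  obtain ⟨hper, hint, -, L, hL, hmod⟩ := hf
  obtain ⟨C₁, hC₁⟩ := hvar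
  obtain ⟨C₂, hC₂⟩ := hO
  have hpi := Real.pi_pos
  have hC₁0 : 0 ≤ C₁ := by
    have h := hC₁ 1 le_rfl
    rw [Nat.cast_one, div_one] at h
    exact (Finset.sum_nonneg fun _ _ => abs_nonneg _).trans h
  have hC₂0 : 0 ≤ C₂ := (mul_nonneg (by positivity) (hpos 0 0 le_rfl)).trans (hC₂ 0)
  have hbound : ∀ u, ∫ x in (0 : ℝ)..(2 * π), |f (x + u) - f x| ≤ 2 * π * L * |u| ^ α := by
    intro u
    rcases eq_or_ne u 0 with rfl | hu
    · simp [Real.zero_rpow hα0.ne']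
    · rw [mul_assoc]
      exact (integral_abs_sub_le_intModulus hper hint hu).trans
        (mul_le_mul_of_nonneg_left (hmod _ (abs_pos.mpr hu)) (by positivity))
  have hpow : Continuous fun u : ℝ => |u| ^ α :=
    (Real.continuous_rpow_const hα0.le).comp continuous_abs
  set B := (C₁ + C₂) * (π ^ 2 / 2) with hB
  refine ⟨2 * L / π * (2 + B / (1 - α)), fun n hn => ?_⟩
  have hn1 : (1 : ℝ) ≤ n := by exact_mod_cast hn
  have hn0 : (0 : ℝ) < n := by linarith
  set K := dirichletMean (a n) n with hKdef
  have hK : Continuous K := continuous_dirichletMean _ _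
  have hsmall : ∀ u, |K u| ≤ 2 * n := fun u =>
    (abs_dirichletMean_le (hpos n) (hsum n) u).trans (by linarith)
  have hlarge : ∀ u, 0 < u → u ≤ π → |K u| ≤ B / n / u ^ 2 := by
    intro u hu hu'
    have hlast : |a n n| ≤ C₂ / n := by
      rw [abs_of_nonneg (hpos n n le_rfl), le_div_iff₀ hn0]
      linarith [hC₂ n, hpos n n le_rfl]
    refine (abs_dirichletMean_le_variation (a n) n hu.ne'
      (by rwa [abs_of_pos hu])).trans ?_
    refine (mul_le_mul_of_nonneg_right (add_le_add (hC₁ n hn) hlast) (by positivity)).trans_eq ?_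
    rw [hB]
    ring
  have hmoment : ∫ u in (-π)..π, 2 * π * L * |u| ^ α * |K u|
      ≤ 2 * π * L * (2 * ((2 + B / (1 - α)) * (n : ℝ) ^ (-α))) := by
    simp only [mul_assoc (2 * π * L)]
    rw [intervalIntegral.integral_const_mul, integral_even_eq_two_mul (g := fun u => |u| ^ α * |K u|)
      (hpow.mul hK.abs) (fun u => by simp only [abs_neg, hKdef, dirichletMean_neg])]
    have habs : ∫ u in (0 : ℝ)..π, |u| ^ α * |K u| = ∫ u in (0 : ℝ)..π, u ^ α * |K u| := by
      refine intervalIntegral.integral_congr fun u hu => ?_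
      rw [Set.uIcc_of_le hpi.le] at hu
      simp only [abs_of_nonneg hu.1]
    rw [habs]
    have := integral_rpow_mul_abs_le hα0 hα1 hK hn1 (by positivity) hsmall hlarge
    gcongr
  simp only [_root_.lpNorm, Real.rpow_one, div_one, matrixMeans_eq_integral hint,
    convolution_sub_eq hper hint hK (dirichletMean_neg _ _) (dirichletMean_periodic _ _)
      (integral_dirichletMean (hsum n)), abs_mul, intervalIntegral.integral_const_mul, ← hKdef]
  have hmain := (integral_abs_integral_sub_mul_le hper hint hK (continuous_const.mul hpow)
    hbound).trans hmoment
  rw [abs_of_pos (by positivity : 0 < 1 / π)]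
  refine (mul_le_mul_of_nonneg_left (mul_le_mul_of_nonneg_left hmain
    (by positivity : 0 ≤ 1 / π)) (by positivity : 0 ≤ 1 / (2 * π))).trans_eq ?_
  field_simp
end

section
/- Let f ∈ Lip(α,1) with 0 < α < 1, and let (a_{n,k}) be a lower triangular matrix with a_{n,k} ≥ 0 for k ≤ n, a_{n,k} = 0 for k > n, and ∑_{k=0}^n a_{n,k} = 1 for all n. If the rows (a_{n,k})_{k=0}^n belong to RBVS with a constant independent of n, i.e., ∑_{k=m}^∞ |a_{n,k} − a_{n,k+1}| ≤ K a_{n,m} for all 0 ≤ m ≤ n and all n, and (n+1)a_{n,0} = O(1), then ‖T_n(f) − f‖_{L^1} = O(n^{−α}). -/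
open MeasureTheory Finset Real

/-- The kernel `∑_{k ≤ n} c_k D_k` of the means `∑_{k ≤ n} c_k S_k`. -/
noncomputable def meansKernel (c : ℕ → ℝ) (n : ℕ) (u : ℝ) : ℝ :=
  ∑ k ∈ Finset.range (n + 1), c k * dirichletKernel k u

lemma continuous_meansKernel (c : ℕ → ℝ) (n : ℕ) : Continuous (meansKernel c n) := by
  have := continuous_dirichletKernel
  unfold meansKernel
  fun_prop

lemma meansKernel_neg (c : ℕ → ℝ) (n : ℕ) (u : ℝ) : meansKernel c n (-u) = meansKernel c n u := by
  simp [meansKernel, dirichletKernel_neg]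

lemma two_mul_one_sub_cos_mul_dirichletKernel (k : ℕ) (u : ℝ) :
    2 * (1 - Real.cos u) * dirichletKernel k u
      = Real.cos (k * u) - Real.cos (((k + 1 : ℕ) : ℝ) * u) := by
  induction k with
  | zero =>
    simp only [dirichletKernel]
    norm_num
    ring
  | succ k ih =>
    have hrec : dirichletKernel (k + 1) u
        = dirichletKernel k u + Real.cos (((k + 1 : ℕ) : ℝ) * u) := by
      simp only [dirichletKernel, Finset.sum_Icc_succ_top (Nat.le_add_left 1 k), add_assoc]
    have h1 : Real.cos (((k + 1 + 1 : ℕ) : ℝ) * u) + Real.cos (k * u)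
        = 2 * Real.cos u * Real.cos (((k + 1 : ℕ) : ℝ) * u) := by
      rw [show ((k + 1 + 1 : ℕ) : ℝ) * u = ((k + 1 : ℕ) : ℝ) * u + u by push_cast; ring,
        show (k : ℝ) * u = ((k + 1 : ℕ) : ℝ) * u - u by push_cast; ring,
        Real.cos_add, Real.cos_sub]
      ring
    rw [hrec, mul_add, ih]
    linarith

/-- Summation by parts for sums against the increments of a sequence starting at `1`. -/
lemma sum_mul_sub_succ_eq (c g : ℕ → ℝ) (hg : g 0 = 1) (N : ℕ) :
    ∑ k ∈ Finset.range N, c k * (g k - g (k + 1))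
      = ∑ k ∈ Finset.range N, (c k - c (k + 1)) * (1 - g (k + 1)) + c N * (1 - g N) := by
  induction N with
  | zero => simp [hg]
  | succ N ih =>
    rw [Finset.sum_range_succ, Finset.sum_range_succ, ih]
    ring

lemma abs_meansKernel_le {c : ℕ → ℝ} {n : ℕ} (hpos : ∀ k ≤ n, 0 ≤ c k)
    (hsum : ∑ k ∈ Finset.range (n + 1), c k = 1) (u : ℝ) :
    |meansKernel c n u| ≤ n + 1 := by
  calc |meansKernel c n u| ≤ ∑ k ∈ Finset.range (n + 1), |c k * dirichletKernel k u| :=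
        Finset.abs_sum_le_sum_abs _ _
    _ ≤ ∑ k ∈ Finset.range (n + 1), c k * ((n : ℝ) + 1) := by
        refine Finset.sum_le_sum fun k hk => ?_
        have hk' : k ≤ n := Nat.lt_succ_iff.mp (Finset.mem_range.mp hk)
        rw [abs_mul, abs_of_nonneg (hpos k hk')]
        refine mul_le_mul_of_nonneg_left ((abs_dirichletKernel_le k u).trans ?_) (hpos k hk')
        gcongr
    _ = n + 1 := by rw [← Finset.sum_mul, hsum, one_mul]

lemma one_sub_cos_mul_abs_meansKernel_le {c : ℕ → ℝ} {n : ℕ} (hc : c (n + 1) = 0) (u : ℝ) :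
    (1 - Real.cos u) * |meansKernel c n u|
      ≤ ∑ k ∈ Finset.range (n + 1), |c k - c (k + 1)| := by
  have h0 : 0 ≤ 1 - Real.cos u := sub_nonneg.mpr (Real.cos_le_one u)
  have h1 : 2 * (1 - Real.cos u) * meansKernel c n u
      = ∑ k ∈ Finset.range (n + 1),
          (c k - c (k + 1)) * (1 - Real.cos (((k + 1 : ℕ) : ℝ) * u)) := by
    have := sum_mul_sub_succ_eq c (fun k => Real.cos (k * u)) (by simp) (n + 1)
    rw [hc, zero_mul, add_zero] at this
    rw [← this, meansKernel, Finset.mul_sum]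
    refine Finset.sum_congr rfl fun k _ => ?_
    rw [← two_mul_one_sub_cos_mul_dirichletKernel]
    ring
  have h2 : |2 * (1 - Real.cos u) * meansKernel c n u|
      ≤ ∑ k ∈ Finset.range (n + 1), |c k - c (k + 1)| * 2 := by
    rw [h1]
    refine (Finset.abs_sum_le_sum_abs _ _).trans (Finset.sum_le_sum fun k _ => ?_)
    rw [abs_mul]
    refine mul_le_mul_of_nonneg_left ?_ (abs_nonneg _)
    rw [abs_le]
    constructor <;> linarith [Real.neg_one_le_cos (((k + 1 : ℕ) : ℝ) * u),
      Real.cos_le_one (((k + 1 : ℕ) : ℝ) * u)]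
  rw [abs_mul, abs_of_nonneg (by linarith : (0:ℝ) ≤ 2 * (1 - Real.cos u)), ← Finset.sum_mul] at h2
  linarith

lemma sq_mul_abs_meansKernel_le {c : ℕ → ℝ} {n : ℕ} (hc : c (n + 1) = 0) {u : ℝ} (hu : |u| ≤ π) :
    u ^ 2 * |meansKernel c n u|
      ≤ π ^ 2 / 2 * ∑ k ∈ Finset.range (n + 1), |c k - c (k + 1)| := by
  have h1 := one_sub_cos_mul_abs_meansKernel_le hc u
  have h2 : 2 / π ^ 2 * u ^ 2 ≤ 1 - Real.cos u := by
    linarith [Real.cos_le_one_sub_mul_cos_sq hu]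
  have h3 := (mul_le_mul_of_nonneg_right h2 (abs_nonneg (meansKernel c n u))).trans h1
  calc u ^ 2 * |meansKernel c n u|
      = π ^ 2 / 2 * (2 / π ^ 2 * u ^ 2 * |meansKernel c n u|) := by
        have := Real.pi_pos
        field_simp
    _ ≤ _ := by gcongr

lemma integral_meansKernel {c : ℕ → ℝ} {n : ℕ}
    (hsum : ∑ k ∈ Finset.range (n + 1), c k = 1) :
    ∫ u in (-π)..π, meansKernel c n u = π := by
  unfold meansKernel
  rw [intervalIntegral.integral_finsetSum fun k _ =>
    ((continuous_dirichletKernel k).const_mul _).intervalIntegrable _ _]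
  simp only [intervalIntegral.integral_const_mul, integral_dirichletKernel]
  rw [← Finset.sum_mul, hsum, one_mul]

/-- Integral of a Fejér-type kernel against the weight `u ^ α`. -/
lemma integral_abs_mul_rpow_le {α : ℝ} (hα0 : 0 < α) (hα1 : α < 1) {n : ℕ} (hn : 1 ≤ n)
    {k : ℝ → ℝ} (hk : Continuous k) {M : ℝ} (hM : 0 ≤ M) (h1 : ∀ u, |k u| ≤ 2 * n)
    (h2 : ∀ u, |u| ≤ π → u ^ 2 * |k u| ≤ M / n) :
    ∫ u in (0 : ℝ)..π, |k u| * u ^ α ≤ (2 + M / (1 - α)) * (n : ℝ) ^ (-α) := by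
  have hn0 : (0 : ℝ) < n := by exact_mod_cast hn
  have hn1 : (n : ℝ)⁻¹ ≤ π :=
    (inv_le_one_of_one_le₀ (by exact_mod_cast hn)).trans (by linarith [Real.pi_gt_three])
  have hinv : (0 : ℝ) < (n : ℝ)⁻¹ := inv_pos.mpr hn0
  have hcont : Continuous fun u : ℝ => |k u| * u ^ α :=
    hk.abs.mul (Real.continuous_rpow_const hα0.le)
  have hnear : ∫ u in (0 : ℝ)..(n : ℝ)⁻¹, |k u| * u ^ α ≤ 2 * (n : ℝ) ^ (-α) := by
    calc ∫ u in (0 : ℝ)..(n : ℝ)⁻¹, |k u| * u ^ α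
        ≤ ∫ u in (0 : ℝ)..(n : ℝ)⁻¹, 2 * n * (n : ℝ)⁻¹ ^ α := by
          refine intervalIntegral.integral_mono_on hinv.le (hcont.intervalIntegrable _ _)
            (by simp) fun u hu => ?_
          exact mul_le_mul (h1 u) (Real.rpow_le_rpow hu.1 hu.2 hα0.le)
            (Real.rpow_nonneg hu.1 _) (by positivity)
      _ = 2 * (n : ℝ) ^ (-α) := by
          rw [intervalIntegral.integral_const, Real.inv_rpow hn0.le, ← Real.rpow_neg hn0.le]
          simp only [smul_eq_mul, sub_zero]
          field_simp
  have hmem : (0 : ℝ) ∉ Set.uIcc (n : ℝ)⁻¹ π := by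
    rw [Set.uIcc_of_le hn1]
    exact fun h => absurd h.1 (not_le.mpr hinv)
  have hfar : ∫ u in (n : ℝ)⁻¹..π, |k u| * u ^ α ≤ M / (1 - α) * (n : ℝ) ^ (-α) := by
    calc ∫ u in (n : ℝ)⁻¹..π, |k u| * u ^ α
        ≤ ∫ u in (n : ℝ)⁻¹..π, M / n * u ^ (α - 2) := by
          refine intervalIntegral.integral_mono_on hn1 (hcont.intervalIntegrable _ _)
            ((intervalIntegral.intervalIntegrable_rpow (Or.inr hmem)).const_mul _) fun u hu => ?_
          have hu0 : 0 < u := hinv.trans_le hu.1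
          have hsplit : u ^ α = u ^ 2 * u ^ (α - 2) := by
            rw [← Real.rpow_natCast u 2, ← Real.rpow_add hu0]
            norm_num
          rw [hsplit, ← mul_assoc, mul_comm |k u|]
          exact mul_le_mul_of_nonneg_right (h2 u (by rw [abs_of_pos hu0]; exact hu.2))
            (Real.rpow_nonneg hu0.le _)
      _ = M / n * (((n : ℝ) ^ (1 - α) - π ^ (α - 1)) / (1 - α)) := by
          rw [intervalIntegral.integral_const_mul,
            integral_rpow (Or.inr ⟨by linarith, hmem⟩), show α - 2 + 1 = α - 1 by ring,
            Real.inv_rpow hn0.le, ← Real.rpow_neg hn0.le, neg_sub, ← neg_sub 1 α, div_neg,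
            ← neg_div, neg_sub, neg_sub]
      _ ≤ M / n * ((n : ℝ) ^ (1 - α) / (1 - α)) := by
          have : 0 < 1 - α := by linarith
          gcongr
          linarith [Real.rpow_nonneg Real.pi_pos.le (α - 1)]
      _ = M / (1 - α) * (n : ℝ) ^ (-α) := by
          rw [sub_eq_add_neg 1 α, Real.rpow_add hn0, Real.rpow_one]
          have : 0 < 1 + -α := by linarith
          field_simp
  rw [← intervalIntegral.integral_add_adjacent_intervals (hcont.intervalIntegrable 0 (n : ℝ)⁻¹)
    (hcont.intervalIntegrable _ _), add_mul]
  exact add_le_add hnear hfar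

section Periodic

variable {f : ℝ → ℝ}

lemma matrixMeans_sub_eq_integral (hper : Function.Periodic f (2 * π))
    (hint : ∀ s t, IntervalIntegrable f volume s t) (a : ℕ → ℕ → ℝ) (n : ℕ)
    (hsum : ∑ k ∈ Finset.range (n + 1), a n k = 1) (x : ℝ) :
    matrixMeans a f n x - f x
      = (1 / π) * ∫ u in (-π)..π, (f (x - u) - f x) * meansKernel (a n) n u := by
  have hshift : IntervalIntegrable (fun u => f (x - u)) volume (-π) π := by
    simpa using (hint (x - -π) (x - π)).comp_sub_left x
  have hS : ∀ k, partialFourierSum f k x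
      = (1 / π) * ∫ u in (-π)..π, f (x - u) * dirichletKernel k u := by
    intro k
    have hp : Function.Periodic (fun t => f t * dirichletKernel k (x - t)) (2 * π) := by
      intro t
      simp only [hper t, ← sub_sub, (dirichletKernel_periodic k).sub_eq]
    have h1 := hp.intervalIntegral_add_eq 0 (x - π)
    rw [zero_add, show x - π + 2 * π = x + π by ring] at h1
    have h2 := intervalIntegral.integral_comp_sub_left
      (fun t => f t * dirichletKernel k (x - t)) x (a := -π) (b := π)
    simp only [sub_sub_cancel, sub_neg_eq_add] at h2
    rw [partialFourierSum, h1, h2]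
  have hT : matrixMeans a f n x
      = (1 / π) * ∫ u in (-π)..π, f (x - u) * meansKernel (a n) n u := by
    simp only [matrixMeans, hS, meansKernel, Finset.mul_sum]
    rw [intervalIntegral.integral_finsetSum, Finset.mul_sum]
    · refine Finset.sum_congr rfl fun k _ => ?_
      rw [mul_left_comm, ← intervalIntegral.integral_const_mul]
      simp only [mul_left_comm]
    · exact fun k _ => hshift.mul_continuousOn
        ((continuous_dirichletKernel k).const_mul _).continuousOn
  have hK := (continuous_meansKernel (a n) n)
  simp only [sub_mul]
  rw [intervalIntegral.integral_sub (hshift.mul_continuousOn hK.continuousOn)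
    ((hK.const_mul _).intervalIntegrable _ _), intervalIntegral.integral_const_mul,
    integral_meansKernel hsum, mul_sub, ← hT]
  have := Real.pi_ne_zero
  field_simp

lemma integral_abs_translate_sub_le (hper : Function.Periodic f (2 * π))
    (hint : ∀ s t, IntervalIntegrable f volume s t) (h : ℝ) :
    ∫ x in (0 : ℝ)..(2 * π), |f (x + h) - f x| ≤ 2 * ∫ x in (0 : ℝ)..(2 * π), |f x| := by
  have hh : IntervalIntegrable (fun x => f (x + h)) volume 0 (2 * π) := by
    simpa using (hint (0 + h) (2 * π + h)).comp_add_right h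
  have hshift : ∫ x in (0 : ℝ)..(2 * π), |f (x + h)| = ∫ x in (0 : ℝ)..(2 * π), |f x| := by
    have hp : Function.Periodic (fun x => |f x|) (2 * π) := fun x => by simp only [hper x]
    rw [intervalIntegral.integral_comp_add_right (fun x => |f x|), add_comm (2 * π) h,
      zero_add, hp.intervalIntegral_add_eq h 0, zero_add]
  calc ∫ x in (0 : ℝ)..(2 * π), |f (x + h) - f x|
      ≤ ∫ x in (0 : ℝ)..(2 * π), (|f (x + h)| + |f x|) :=
        intervalIntegral.integral_mono_on (by positivity) (hh.sub (hint _ _)).abs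
          (hh.abs.add (hint _ _).abs) fun x _ => abs_sub _ _
    _ = _ := by
        rw [intervalIntegral.integral_add hh.abs (hint _ _).abs, hshift]
        ring

/-- The modulus of continuity dominates each individual translate. -/
lemma integral_abs_translate_sub_le_intModulus (hper : Function.Periodic f (2 * π))
    (hint : ∀ s t, IntervalIntegrable f volume s t) {h : ℝ} (hh : h ≠ 0) :
    ∫ x in (0 : ℝ)..(2 * π), |f (x + h) - f x| ≤ 2 * π * intModulus 1 f |h| := by
  have hpi := Real.pi_pos
  have hle : (1 / (2 * π)) * ∫ x in (0 : ℝ)..(2 * π), |f (x + h) - f x|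
      ≤ intModulus 1 f |h| := by
    refine le_csSup ⟨(1 / (2 * π)) * (2 * ∫ x in (0 : ℝ)..(2 * π), |f x|), ?_⟩
      ⟨h, abs_pos.mpr hh, le_rfl, by simp⟩
    rintro y ⟨t, -, -, rfl⟩
    simp only [Real.rpow_one, div_one]
    exact mul_le_mul_of_nonneg_left (integral_abs_translate_sub_le hper hint t) (by positivity)
  calc _ = 2 * π * ((1 / (2 * π)) * ∫ x in (0 : ℝ)..(2 * π), |f (x + h) - f x|) := by
        field_simp
    _ ≤ _ := by gcongr

lemma integral_abs_translate_sub_le_rpow {α : ℝ} (hα0 : 0 < α)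
    (hper : Function.Periodic f (2 * π))
    (hint : ∀ s t, IntervalIntegrable f volume s t) {C : ℝ}
    (hC : ∀ δ : ℝ, 0 < δ → intModulus 1 f δ ≤ C * δ ^ α) (h : ℝ) :
    ∫ x in (0 : ℝ)..(2 * π), |f (x + h) - f x| ≤ 2 * π * (C * |h| ^ α) := by
  rcases eq_or_ne h 0 with rfl | hh
  · simp [Real.zero_rpow hα0.ne']
  · refine (integral_abs_translate_sub_le_intModulus hper hint hh).trans ?_
    have := hC |h| (abs_pos.mpr hh)
    have := Real.pi_pos
    gcongr

/-- Minkowski's inequality for averages of translates. -/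
lemma integral_abs_integral_translate_sub_mul_le
    (hint : ∀ s t, IntervalIntegrable f volume s t) {k g : ℝ → ℝ} (hk : Continuous k)
    (hg : Continuous g)
    (hfg : ∀ h, ∫ x in (0 : ℝ)..(2 * π), |f (x + h) - f x| ≤ g h) :
    ∫ x in (0 : ℝ)..(2 * π), |∫ u in (-π)..π, (f (x - u) - f x) * k u|
      ≤ ∫ u in (-π)..π, |k u| * g (-u) := by
  have hpi := Real.pi_pos
  have h2pi : (0 : ℝ) ≤ 2 * π := by positivity
  have hnpi : -π ≤ π := by linarith
  have hg0 : ∀ h, 0 ≤ g h := fun h =>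
    (intervalIntegral.integral_nonneg h2pi fun x _ => abs_nonneg _).trans (hfg h)
  have hfm : AEStronglyMeasurable f volume :=
    (locallyIntegrable_iff.mpr fun K hK => by
      obtain ⟨r, hr⟩ := hK.isBounded.subset_closedBall 0
      rw [Real.closedBall_eq_Icc] at hr
      exact ((intervalIntegrable_iff' (by simp)).mp (hint (0 - r) (0 + r))).mono_set
        (hr.trans Set.Icc_subset_uIcc)).aestronglyMeasurable
  have hmeas : AEStronglyMeasurable (fun p : ℝ × ℝ => (f (p.1 - p.2) - f p.1) * k p.2)
      ((volume.restrict (Set.Ioc 0 (2 * π))).prod (volume.restrict (Set.Ioc (-π) π))) := by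
    rw [Measure.prod_restrict]
    refine AEStronglyMeasurable.restrict (AEStronglyMeasurable.mul (.sub ?_ ?_) ?_)
    · exact hfm.comp_quasiMeasurePreserving
        (quasiMeasurePreserving_sub_of_right_invariant volume volume)
    · exact hfm.comp_quasiMeasurePreserving Measure.quasiMeasurePreserving_fst
    · exact (hk.comp continuous_snd).aestronglyMeasurable
  have hinner : ∀ u, ∫⁻ x in Set.Ioc 0 (2 * π), ‖(f (x - u) - f x) * k u‖ₑ
      ≤ ENNReal.ofReal (|k u| * g (-u)) := by
    intro u
    have hu : IntervalIntegrable (fun x => f (x + -u)) volume 0 (2 * π) := by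
      simpa using (hint (0 + -u) (2 * π + -u)).comp_add_right (-u)
    have hi : IntegrableOn (fun x => (f (x + -u) - f x) * k u) (Set.Ioc 0 (2 * π)) :=
      (intervalIntegrable_iff_integrableOn_Ioc_of_le h2pi).mp
        ((hu.sub (hint _ _)).mul_const _)
    simp only [sub_eq_add_neg _ u]
    rw [← ofReal_integral_norm_eq_lintegral_enorm hi]
    refine ENNReal.ofReal_le_ofReal ?_
    rw [← intervalIntegral.integral_of_le h2pi]
    simp only [norm_mul, Real.norm_eq_abs]
    rw [intervalIntegral.integral_mul_const, mul_comm]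
    exact mul_le_mul_of_nonneg_left (hfg (-u)) (abs_nonneg _)
  have hcont : Continuous fun u => |k u| * g (-u) := hk.abs.mul (hg.comp continuous_neg)
  have hlin : ∫⁻ x in Set.Ioc 0 (2 * π), ‖∫ u in (-π)..π, (f (x - u) - f x) * k u‖ₑ
      ≤ ENNReal.ofReal (∫ u in (-π)..π, |k u| * g (-u)) := by
    calc ∫⁻ x in Set.Ioc 0 (2 * π), ‖∫ u in (-π)..π, (f (x - u) - f x) * k u‖ₑ
        ≤ ∫⁻ x in Set.Ioc 0 (2 * π), ∫⁻ u in Set.Ioc (-π) π, ‖(f (x - u) - f x) * k u‖ₑ := by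
          refine lintegral_mono fun x => ?_
          rw [intervalIntegral.integral_of_le hnpi]
          exact enorm_integral_le_lintegral_enorm _
      _ = ∫⁻ u in Set.Ioc (-π) π, ∫⁻ x in Set.Ioc 0 (2 * π), ‖(f (x - u) - f x) * k u‖ₑ :=
          lintegral_lintegral_swap hmeas.enorm
      _ ≤ ∫⁻ u in Set.Ioc (-π) π, ENNReal.ofReal (|k u| * g (-u)) := lintegral_mono hinner
      _ = _ := by
          rw [intervalIntegral.integral_of_le hnpi, ofReal_integral_eq_lintegral_ofReal]
          · exact (intervalIntegrable_iff_integrableOn_Ioc_of_le hnpi).mp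
              (hcont.intervalIntegrable _ _)
          · exact Filter.Eventually.of_forall fun u => mul_nonneg (abs_nonneg _) (hg0 _)
  have hnn : 0 ≤ ∫ u in (-π)..π, |k u| * g (-u) :=
    intervalIntegral.integral_nonneg hnpi fun u _ => mul_nonneg (abs_nonneg _) (hg0 _)
  rw [intervalIntegral.integral_of_le h2pi]
  refine (Real.le_norm_self _).trans ((norm_integral_le_lintegral_norm _).trans ?_)
  refine ENNReal.toReal_le_of_le_ofReal hnn (le_of_eq_of_le ?_ hlin)
  simp only [Real.norm_eq_abs, abs_abs, Real.enorm_eq_ofReal_abs]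

end Periodic

lemma sum_abs_sub_succ_le {c : ℕ → ℝ} {n : ℕ} (hzero : ∀ k, n < k → c k = 0) {K B : ℝ}
    (h0 : 0 ≤ c 0) (hK : ∑' k : ℕ, |c (0 + k) - c (0 + k + 1)| ≤ K * c 0)
    (hB : ((n : ℝ) + 1) * c 0 ≤ B) :
    ∑ k ∈ Finset.range (n + 1), |c k - c (k + 1)| ≤ |K| * B / ((n : ℝ) + 1) := by
  have htsum : ∑' k : ℕ, |c (0 + k) - c (0 + k + 1)|
      = ∑ k ∈ Finset.range (n + 1), |c k - c (k + 1)| := by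
    simp only [zero_add]
    refine tsum_eq_sum fun k hk => ?_
    have hk' : n < k := by simpa using hk
    simp [hzero k hk', hzero (k + 1) (by omega)]
  rw [← htsum]
  refine hK.trans ((mul_le_mul_of_nonneg_right (le_abs_self K) h0).trans ?_)
  rw [le_div_iff₀ (by positivity), mul_assoc, mul_comm (c 0)]
  exact mul_le_mul_of_nonneg_left hB (abs_nonneg K)

/-- Integral over a symmetric interval of an even kernel against `|u| ^ α`. -/
lemma integral_symm_abs_mul_rpow {α : ℝ} (hα0 : 0 < α) {k : ℝ → ℝ} (hk : Continuous k)
    (heven : ∀ u, k (-u) = k u) :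
    ∫ u in (-π)..π, |k u| * |u| ^ α = 2 * ∫ u in (0 : ℝ)..π, |k u| * u ^ α := by
  have hcont : Continuous fun u : ℝ => |k u| * |u| ^ α :=
    hk.abs.mul ((Real.continuous_rpow_const hα0.le).comp continuous_abs)
  have hneg : ∫ u in (-π)..0, |k u| * |u| ^ α = ∫ u in (0 : ℝ)..π, |k u| * |u| ^ α := by
    have := intervalIntegral.integral_comp_neg (fun u => |k u| * |u| ^ α) (a := 0) (b := π)
    simpa [heven] using this.symm
  have hpos : ∫ u in (0 : ℝ)..π, |k u| * |u| ^ α = ∫ u in (0 : ℝ)..π, |k u| * u ^ α := by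
    refine intervalIntegral.integral_congr fun u hu => ?_
    rw [Set.uIcc_of_le Real.pi_pos.le] at hu
    simp only [abs_of_nonneg hu.1]
  rw [← intervalIntegral.integral_add_adjacent_intervals (hcont.intervalIntegrable (-π) 0)
    (hcont.intervalIntegrable 0 π), hneg, hpos, two_mul]

/-- Theorem 5 (v): if `f ∈ Lip(α,1)`, `0 < α < 1`, the matrix is
nonnegative, lower triangular with row sums `1`, its rows are in `RBVS` with a constant
independent of `n` (`∑_{k=m}^∞ |a_{n,k} - a_{n,k+1}| ≤ K a_{n,m}` for `0 ≤ m ≤ n`),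
and `(n+1)a_{n,0} = O(1)`, then `‖T_n(f) - f‖_{L^1} = O(n^{-α})`. -/
theorem trig_approx_RBVS (α : ℝ) (hα0 : 0 < α) (hα1 : α < 1)
    (f : ℝ → ℝ) (hf : LipClass α 1 f)
    (a : ℕ → ℕ → ℝ)
    (hpos : ∀ n k, k ≤ n → 0 ≤ a n k)
    (hzero : ∀ n k, n < k → a n k = 0)
    (hsum : ∀ n, ∑ k ∈ Finset.range (n + 1), a n k = 1)
    (hRBVS : ∃ K : ℝ, ∀ n m : ℕ, m ≤ n →
      (∑' k : ℕ, |a n (m + k) - a n (m + k + 1)|) ≤ K * a n m)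
    (hO : ∃ C : ℝ, ∀ n : ℕ, ((n : ℝ) + 1) * a n 0 ≤ C) :
    ∃ C : ℝ, ∀ n : ℕ, 1 ≤ n →
      lpNorm 1 (fun x => matrixMeans a f n x - f x) ≤ C * (n : ℝ) ^ (-α) := by
  obtain ⟨hper, hf1, -, C, hC0, hC⟩ := hf
  obtain ⟨K, hK⟩ := hRBVS
  obtain ⟨B, hB⟩ := hO
  have hpi := Real.pi_pos
  have hint := hper.intervalIntegrable₀ Real.two_pi_pos.ne' hf1
  have hB0 : 0 ≤ B := le_trans (by have := hpos 0 0 le_rfl; positivity) (hB 0)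
  set M : ℝ := π ^ 2 / 2 * (|K| * B) with hMdef
  have hM : 0 ≤ M := by positivity
  refine ⟨2 * C / π * (2 + M / (1 - α)), fun n hn => ?_⟩
  have hn0 : (0 : ℝ) < n := by exact_mod_cast hn
  have hn1 : (1 : ℝ) ≤ n := by exact_mod_cast hn
  set k := meansKernel (a n) n with hkdef
  have hk : Continuous k := continuous_meansKernel _ _
  have hkernel : ∫ u in (0 : ℝ)..π, |k u| * u ^ α ≤ (2 + M / (1 - α)) * (n : ℝ) ^ (-α) := by
    refine integral_abs_mul_rpow_le hα0 hα1 hn hk hM (fun u => ?_) fun u hu => ?_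
    · linarith [abs_meansKernel_le (hpos n) (hsum n) u]
    · refine (sq_mul_abs_meansKernel_le (hzero n (n + 1) n.lt_succ_self) hu).trans ?_
      have h1 := sum_abs_sub_succ_le (hzero n) (hpos n 0 n.zero_le) (hK n 0 n.zero_le) (hB n)
      calc π ^ 2 / 2 * ∑ k ∈ Finset.range (n + 1), |a n k - a n (k + 1)|
          ≤ π ^ 2 / 2 * (|K| * B / ((n : ℝ) + 1)) := by gcongr
        _ ≤ π ^ 2 / 2 * (|K| * B / n) := by gcongr; linarith
        _ = M / n := by rw [hMdef, mul_div_assoc (π ^ 2 / 2)]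
  have hmink := integral_abs_integral_translate_sub_mul_le hint hk
    (g := fun h => 2 * π * (C * |h| ^ α))
    (((Real.continuous_rpow_const hα0.le).comp continuous_abs |>.const_mul C).const_mul _)
    (integral_abs_translate_sub_le_rpow hα0 hper hint hC)
  have hright : ∫ u in (-π)..π, |k u| * (2 * π * (C * |-u| ^ α))
      = 4 * π * C * ∫ u in (0 : ℝ)..π, |k u| * u ^ α := by
    have : ∀ u : ℝ, |k u| * (2 * π * (C * |-u| ^ α)) = 2 * π * C * (|k u| * |u| ^ α) := by
      intro u
      rw [abs_neg]
      ring
    simp only [this]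
    rw [intervalIntegral.integral_const_mul,
      integral_symm_abs_mul_rpow hα0 hk (meansKernel_neg _ _)]
    ring
  rw [hright] at hmink
  have hnorm : lpNorm 1 (fun x => matrixMeans a f n x - f x)
      = (1 / (2 * π)) * ((1 / π) *
        ∫ x in (0 : ℝ)..(2 * π), |∫ u in (-π)..π, (f (x - u) - f x) * k u|) := by
    simp only [_root_.lpNorm, Real.rpow_one, div_one,
      matrixMeans_sub_eq_integral hper hint a n (hsum n), abs_mul,
      abs_of_pos (one_div_pos.mpr hpi), intervalIntegral.integral_const_mul, hkdef]
  rw [hnorm]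
  calc _ ≤ (1 / (2 * π)) * ((1 / π) *
        (4 * π * C * ((2 + M / (1 - α)) * (n : ℝ) ^ (-α)))) := by
        have := mul_le_mul_of_nonneg_left hkernel (by positivity : 0 ≤ 4 * π * C)
        have := hmink.trans this
        gcongr
    _ = _ := by
        field_simp
        ring
end
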